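/- arXiv:1605.08836 — 4 statements merged into one kernel-verified Lean document; each statement's English description precedes it below -/
import Mathlib

section
/- Let β > −1 and let u be a bounded smooth function on the punctured cone ball {0 < ρ < 1} (2π-periodic in θ) with △̃u = 0. Then for every q > 0, u has an expansion up to order q: there exist real numbers a_v for v ∈ T^q such that u − Σ_{v∈T^q} a_v v belongs to Õ(q) on {0 < ρ < 1/2}. -/
open Real

/-- The operator `ρ ∂/∂ρ` on functions `u(ρ,θ)`. -/
noncomputable def pdRho (u : ℝ → ℝ → ℝ) : ℝ → ℝ → ℝ :=
  fun ρ θ => ρ * deriv (fun r => u r θ) ρ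

/-- The operator `∂/∂θ` on functions `u(ρ,θ)`. -/
noncomputable def pdTheta (u : ℝ → ℝ → ℝ) : ℝ → ℝ → ℝ :=
  fun ρ θ => deriv (fun s => u ρ s) θ

/-- The cone Laplacian `△̃ = ∂²/∂ρ² + ρ⁻¹ ∂/∂ρ + (β+1)⁻² ρ⁻² ∂²/∂θ²`. -/
noncomputable def coneLap (β : ℝ) (u : ℝ → ℝ → ℝ) (ρ θ : ℝ) : ℝ :=
  deriv (fun r => deriv (fun r' => u r' θ) r) ρ
    + ρ⁻¹ * deriv (fun r => u r θ) ρ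
    + ((β + 1) ^ 2)⁻¹ * (ρ ^ 2)⁻¹ * deriv (fun s => deriv (fun s' => u ρ s') s) θ

/-- The class `Õ(q)` on `{0 < ρ < 1/2}`: for all nonnegative integers `k₁, k₂` there is
a constant `C(k₁,k₂)` with `|(ρ∂_ρ)^{k₁} ∂_θ^{k₂} u| ≤ C(k₁,k₂) ρ^q`. -/
def Otilde (q : ℝ) (u : ℝ → ℝ → ℝ) : Prop :=
  ∀ k₁ k₂ : ℕ, ∃ C : ℝ, ∀ ρ θ : ℝ, 0 < ρ → ρ < 1 / 2 →
    |pdRho^[k₁] (pdTheta^[k₂] u) ρ θ| ≤ C * ρ ^ q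

/-- The index `(j,k,l)` contributes to `T^q`: `(k-l)/2 ∈ ℕ ∪ {0}` and
`2j + k/(β+1) < q`. -/
def goodIdx (β q : ℝ) (j k l : ℕ) : Prop :=
  (∃ m : ℕ, k = l + 2 * m) ∧ 2 * (j : ℝ) + (k : ℝ) / (β + 1) < q

/-- The (finitely supported) sum `Σ a_{jkl} ρ^{2j+k/(β+1)} cos(lθ) + b_{jkl} ρ^{2j+k/(β+1)} sin(lθ)`. -/
noncomputable def expSum (β : ℝ) (a b : ℕ → ℕ → ℕ → ℝ) : ℝ → ℝ → ℝ :=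
  fun ρ θ => ∑ᶠ i : ℕ × ℕ × ℕ,
    (a i.1 i.2.1 i.2.2 * ρ ^ (2 * (i.1 : ℝ) + (i.2.1 : ℝ) / (β + 1)) * Real.cos (i.2.2 * θ)
      + b i.1 i.2.1 i.2.2 * ρ ^ (2 * (i.1 : ℝ) + (i.2.1 : ℝ) / (β + 1)) * Real.sin (i.2.2 * θ))

/-- `u` has an expansion up to order `q`: there are coefficients `a_v`, `v ∈ T^q`,
with `u - Σ_{v ∈ T^q} a_v v ∈ Õ(q)`. -/
def HasExpansion (β q : ℝ) (u : ℝ → ℝ → ℝ) : Prop :=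
  ∃ a b : ℕ → ℕ → ℕ → ℝ,
    (∀ j k l : ℕ, ¬ goodIdx β q j k l → a j k l = 0 ∧ b j k l = 0) ∧
    Otilde q (fun ρ θ => u ρ θ - expSum β a b ρ θ)


/-- Solve the Euler ODE. -/
lemma euler_ode (c d d' : ℝ → ℂ) (p M : ℝ) (hp : 0 ≤ p)
    (hc : ∀ r, 0 < r → r < 1 → HasDerivAt c (d r) r)
    (hd : ∀ r, 0 < r → r < 1 → HasDerivAt d (d' r) r)
    (hode : ∀ r : ℝ, 0 < r → r < 1 → (r:ℂ)^2 * d' r + r * d r = (p:ℂ)^2 * c r)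
    (hM : ∀ r, 0 < r → r < 1 → ‖c r‖ ≤ M) :
    ∃ A : ℂ, ‖A‖ ≤ M ∧ ∀ r, 0 < r → r < 1 → c r = A * ((r^p : ℝ) : ℂ) := by
  have key : ∀ (s : ℝ), s^2 = p^2 → ∃ K : ℂ, ∀ r, 0 < r → r < 1 →
      ((r^(-s):ℝ):ℂ) * (r * d r + s * c r) = K := by
    intro s hs
    have hder : ∀ r ∈ Set.Ioo (0:ℝ) 1,
        HasDerivAt (fun r : ℝ => ((r^(-s):ℝ):ℂ) * (r * d r + s * c r)) 0 r := by
      intro r hr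
      have h1 : HasDerivAt (fun r : ℝ => ((r^(-s):ℝ):ℂ)) (((-s) * r^(-s-1) : ℝ):ℂ) r :=
        (Real.hasDerivAt_rpow_const (Or.inl hr.1.ne')).ofReal_comp
      have h2 : HasDerivAt (fun r : ℝ => (r:ℂ)) 1 r := by
        simpa using (hasDerivAt_id r).ofReal_comp
      have h3 := h1.mul (((h2.mul (hd r hr.1 hr.2))).add ((hc r hr.1 hr.2).const_mul (s:ℂ)))
      convert! h3 using 1
      have hr0 : (r:ℂ) ≠ 0 := by exact_mod_cast hr.1.ne'
      have e1 : ((r^(-s-1):ℝ):ℂ) = ((r^(-s):ℝ):ℂ) / r := by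
        rw [Real.rpow_sub_one hr.1.ne']; push_cast; rfl
      have o := hode r hr.1 hr.2
      have hs' : (s:ℂ)^2 = (p:ℂ)^2 := by exact_mod_cast hs
      rw [← hs'] at o
      simp only [Pi.mul_apply, Pi.add_apply]
      rw [Complex.ofReal_mul, e1]
      push_cast
      field_simp
      linear_combination (-((r^(-s):ℝ):ℂ)) * o
    obtain ⟨K, hK⟩ := isOpen_Ioo.exists_is_const_of_deriv_eq_zero isPreconnected_Ioo
      (fun r hr => (hder r hr).differentiableAt.differentiableWithinAt)
      (fun r hr => (hder r hr).deriv)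
    exact ⟨K, fun r h0 h1 => hK r ⟨h0, h1⟩⟩
  have main : ∃ A : ℂ, ∀ r, 0 < r → r < 1 → c r = A * ((r^p : ℝ) : ℂ) := by
    rcases hp.eq_or_lt with rfl | hp
    · obtain ⟨K, hK⟩ := key 0 rfl
      have hder : ∀ r ∈ Set.Ioo (0:ℝ) 1,
          HasDerivAt (fun r : ℝ => c r - K * (Real.log r : ℂ)) 0 r := by
        intro r hr
        have h3 := (hc r hr.1 hr.2).sub
          (((Real.hasDerivAt_log hr.1.ne').ofReal_comp).const_mul K)
        convert! h3 using 1
        have := hK r hr.1 hr.2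
        have hr0 : (r:ℂ) ≠ 0 := by exact_mod_cast hr.1.ne'
        simp at this
        rw [← this]; push_cast; field_simp; simp
      obtain ⟨B, hB⟩ := isOpen_Ioo.exists_is_const_of_deriv_eq_zero isPreconnected_Ioo
        (fun r hr => (hder r hr).differentiableAt.differentiableWithinAt)
        (fun r hr => (hder r hr).deriv)
      have hK0 : K = 0 := by
        by_contra hne
        have hpos : 0 < ‖K‖ := norm_pos_iff.2 hne
        have hbd : ∀ r, 0 < r → r < 1 → ‖K‖ * |Real.log r| ≤ M + ‖B‖ := by
          intro r h0 h1
          have e : K * (Real.log r : ℂ) = c r - B := by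
            have := hB r ⟨h0, h1⟩
            rw [← this]; ring
          have := norm_sub_le (c r) B
          rw [← e, norm_mul, Complex.norm_real, Real.norm_eq_abs] at this
          linarith [hM r h0 h1]
        have hM0 : 0 ≤ M := (norm_nonneg _).trans (hM (1/2) (by norm_num) (by norm_num))
        have hq : 0 < (M + ‖B‖ + 1) / ‖K‖ := by positivity
        have := hbd (Real.exp (-((M + ‖B‖ + 1) / ‖K‖))) (Real.exp_pos _)
          ((Real.exp_lt_exp.2 (neg_lt_zero.2 hq)).trans_eq Real.exp_zero)
        rw [Real.log_exp, abs_neg, abs_of_pos hq, mul_div_cancel₀ _ hpos.ne'] at this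
        linarith
      refine ⟨B, fun r h0 h1 => ?_⟩
      have := hB r ⟨h0, h1⟩
      simp [hK0] at this
      simp [this]
    · obtain ⟨K, hK⟩ := key p rfl
      obtain ⟨L, hL⟩ := key (-p) (by ring)
      have hL0 : L = 0 := by
        have hev : ∀ᶠ r : ℝ in nhdsWithin 0 (Set.Ioi 0),
            ‖L‖ ≤ ‖K‖ * r^(2*p) + 2*p*M*r^p := by
          filter_upwards [Ioo_mem_nhdsGT (zero_lt_one' ℝ)] with r hr
          have a1 := hK r hr.1 hr.2
          have a2 := hL r hr.1 hr.2
          have hrp : ((r^p:ℝ):ℂ) * ((r^(-p):ℝ):ℂ) = 1 := by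
            rw [← Complex.ofReal_mul, ← Real.rpow_add hr.1]; simp
          have hrp2 : ((r^(2*p):ℝ):ℂ) = ((r^p:ℝ):ℂ) ^2 := by
            rw [mul_comm, Real.rpow_mul hr.1.le]; norm_cast
          rw [neg_neg] at a2
          have e : L = K * ((r^(2*p):ℝ):ℂ) - 2 * p * c r * ((r^p:ℝ):ℂ) := by
            rw [← a1, ← a2, hrp2]
            push_cast
            linear_combination (-((r^p:ℝ):ℂ) * (r * d r + p * c r)) * hrp
          rw [e]
          refine (norm_sub_le _ _).trans ?_
          have hn : ‖(2:ℂ) * p * c r * ((r^p:ℝ):ℂ)‖ = 2 * p * ‖c r‖ * r^p := by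
            simp only [norm_mul, Complex.norm_real, Real.norm_eq_abs, abs_of_pos hp,
              abs_of_pos (Real.rpow_pos_of_pos hr.1 p)]
            simp
          rw [hn, norm_mul, Complex.norm_real, Real.norm_eq_abs,
            abs_of_pos (Real.rpow_pos_of_pos hr.1 _)]
          have := hM r hr.1 hr.2
          have := Real.rpow_pos_of_pos hr.1 p
          gcongr
        have ht : Filter.Tendsto (fun r : ℝ => ‖K‖ * r^(2*p) + 2*p*M*r^p)
            (nhdsWithin 0 (Set.Ioi 0)) (nhds 0) := by
          have : ContinuousAt (fun r : ℝ => ‖K‖ * r^(2*p) + 2*p*M*r^p) 0 := by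
            have c1 := Real.continuousAt_rpow_const 0 (2*p) (Or.inr (by linarith))
            have c2 := Real.continuousAt_rpow_const 0 p (Or.inr (by linarith))
            exact (c1.const_mul _).add (c2.const_mul _)
          have h := this.tendsto
          rw [Real.zero_rpow hp.ne', Real.zero_rpow (by positivity)] at h
          simp only [mul_zero, add_zero] at h
          exact h.mono_left nhdsWithin_le_nhds
        have := ge_of_tendsto ht hev
        simpa using this
      refine ⟨K / (2*p), fun r h0 h1 => ?_⟩
      have a1 := hK r h0 h1
      have a2 := hL r h0 h1
      have hp0 : (p:ℂ) ≠ 0 := by exact_mod_cast hp.ne'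
      have hrp0 : ((r^p:ℝ):ℂ) ≠ 0 := by exact_mod_cast (Real.rpow_pos_of_pos h0 p).ne'
      have hrp : ((r^p:ℝ):ℂ) * ((r^(-p):ℝ):ℂ) = 1 := by
        rw [← Complex.ofReal_mul, ← Real.rpow_add h0]; simp
      rw [neg_neg, hL0, mul_eq_zero, or_iff_right hrp0] at a2
      push_cast at a2
      rw [← a1]
      field_simp
      linear_combination (-(r * d r + p * c r)) * hrp - a2
  obtain ⟨A, hA⟩ := main
  refine ⟨A, ?_, hA⟩
  have hev : ∀ᶠ r : ℝ in nhdsWithin 1 (Set.Iio 1), ‖A‖ * r^p ≤ M := by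
    filter_upwards [Ioo_mem_nhdsLT (zero_lt_one' ℝ)] with r hr
    have := hM r hr.1 hr.2
    rwa [hA r hr.1 hr.2, norm_mul, Complex.norm_real, Real.norm_eq_abs,
      abs_of_pos (Real.rpow_pos_of_pos hr.1 _)] at this
  have ht : Filter.Tendsto (fun r : ℝ => ‖A‖ * r^p) (nhdsWithin 1 (Set.Iio 1)) (nhds ‖A‖) := by
    have h := ((Real.continuousAt_rpow_const 1 p (Or.inl one_ne_zero)).const_mul ‖A‖).tendsto
    rw [Real.one_rpow, mul_one] at h
    exact h.mono_left nhdsWithin_le_nhds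
  exact le_of_tendsto ht hev

lemma param_deriv (w w' : ℝ → ℝ → ℝ) (φ : ℝ → ℂ) (hφ : Continuous φ)
    (hw : ContinuousOn (fun p : ℝ × ℝ => w p.1 p.2) {p : ℝ × ℝ | 0 < p.1 ∧ p.1 < 1})
    (hw' : ContinuousOn (fun p : ℝ × ℝ => w' p.1 p.2) {p : ℝ × ℝ | 0 < p.1 ∧ p.1 < 1})
    (hd : ∀ r t, 0 < r → r < 1 → HasDerivAt (fun r => w r t) (w' r t) r)
    (a b r : ℝ) (h0 : 0 < r) (h1 : r < 1) :
    HasDerivAt (fun r => ∫ t in a..b, φ t * (w r t : ℂ)) (∫ t in a..b, φ t * (w' r t : ℂ)) r := by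
  have slice : ∀ v : ℝ → ℝ → ℝ,
      ContinuousOn (fun p : ℝ × ℝ => v p.1 p.2) {p : ℝ × ℝ | 0 < p.1 ∧ p.1 < 1} →
      ∀ r, 0 < r → r < 1 → Continuous (fun t => φ t * (v r t : ℂ)) := by
    intro v hv r h0 h1
    have : Continuous (fun t => v r t) :=
      hv.comp_continuous (f := fun t => (r, t)) (by fun_prop) (fun t => ⟨h0, h1⟩)
    fun_prop
  let S : Set ℝ := Set.Icc (r/2) ((r+1)/2)
  have hS : S ∈ nhds r := Icc_mem_nhds (by linarith) (by linarith)
  have hSub : ∀ x ∈ S, 0 < x ∧ x < 1 := fun x hx => ⟨by linarith [hx.1], by linarith [hx.2]⟩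
  have hcomp : IsCompact (S ×ˢ Set.uIcc a b) := isCompact_Icc.prod isCompact_uIcc
  have hcon : ContinuousOn (fun p : ℝ × ℝ => φ p.2 * (w' p.1 p.2 : ℂ)) (S ×ˢ Set.uIcc a b) := by
    refine ContinuousOn.mul (by fun_prop) ?_
    refine Complex.continuous_ofReal.comp_continuousOn (hw'.mono ?_)
    intro p hp
    exact hSub _ hp.1
  obtain ⟨C, hC⟩ := hcomp.exists_bound_of_continuousOn hcon
  refine (intervalIntegral.hasDerivAt_integral_of_dominated_loc_of_deriv_le (bound := fun _ => C)
    (F := fun r t => φ t * (w r t : ℂ)) (F' := fun r t => φ t * (w' r t : ℂ))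
    hS ?_ ?_ ?_ ?_ ?_ ?_).2
  · filter_upwards [hS] with x hx
    exact (slice w hw x (hSub x hx).1 (hSub x hx).2).aestronglyMeasurable
  · exact (slice w hw r h0 h1).intervalIntegrable _ _
  · exact (slice w' hw' r h0 h1).aestronglyMeasurable
  · refine Filter.Eventually.of_forall fun t ht x hx => hC (x, t) ⟨hx, Set.uIoc_subset_uIcc ht⟩
  · exact intervalIntegrable_const
  · refine Filter.Eventually.of_forall fun t ht x hx => ?_
    exact ((hd x t (hSub x hx).1 (hSub x hx).2).ofReal_comp).const_mul _

lemma strip_deriv (u : ℝ → ℝ → ℝ)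
    (hs : ContDiffOn ℝ (⊤ : ℕ∞) (fun p : ℝ × ℝ => u p.1 p.2)
      {p : ℝ × ℝ | 0 < p.1 ∧ p.1 < 1}) :
    (ContDiffOn ℝ (⊤ : ℕ∞) (fun p : ℝ × ℝ => deriv (fun r => u r p.2) p.1)
      {p : ℝ × ℝ | 0 < p.1 ∧ p.1 < 1}) ∧
    (ContDiffOn ℝ (⊤ : ℕ∞) (fun p : ℝ × ℝ => deriv (fun s => u p.1 s) p.2)
      {p : ℝ × ℝ | 0 < p.1 ∧ p.1 < 1}) ∧
    (∀ r t, 0 < r → r < 1 → HasDerivAt (fun r => u r t) (deriv (fun r => u r t) r) r) ∧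
    (∀ r t, 0 < r → r < 1 → HasDerivAt (fun s => u r s) (deriv (fun s => u r s) t) t) := by
  have ho : IsOpen {p : ℝ × ℝ | 0 < p.1 ∧ p.1 < 1} :=
    (isOpen_lt continuous_const continuous_fst).inter (isOpen_lt continuous_fst continuous_const)
  have hdf : ∀ p ∈ {p : ℝ × ℝ | 0 < p.1 ∧ p.1 < 1},
      HasFDerivAt (fun p : ℝ × ℝ => u p.1 p.2) (fderiv ℝ (fun p : ℝ × ℝ => u p.1 p.2) p) p := by
    intro p hp
    exact ((hs.contDiffAt (ho.mem_nhds hp)).differentiableAt (by simp)).hasFDerivAt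
  have hA : ∀ p ∈ {p : ℝ × ℝ | 0 < p.1 ∧ p.1 < 1},
      HasDerivAt (fun r => u r p.2) (fderiv ℝ (fun p : ℝ × ℝ => u p.1 p.2) p (1, 0)) p.1 := by
    intro p hp
    exact (hdf p hp).comp_hasDerivAt p.1 ((hasDerivAt_id p.1).prodMk (hasDerivAt_const p.1 p.2))
  have hB : ∀ p ∈ {p : ℝ × ℝ | 0 < p.1 ∧ p.1 < 1},
      HasDerivAt (fun s => u p.1 s) (fderiv ℝ (fun p : ℝ × ℝ => u p.1 p.2) p (0, 1)) p.2 := by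
    intro p hp
    exact (hdf p hp).comp_hasDerivAt p.2 ((hasDerivAt_const p.2 p.1).prodMk (hasDerivAt_id p.2))
  have hfd : ContDiffOn ℝ (⊤ : ℕ∞) (fderiv ℝ (fun p : ℝ × ℝ => u p.1 p.2))
      {p : ℝ × ℝ | 0 < p.1 ∧ p.1 < 1} := hs.fderiv_of_isOpen ho (by simp)
  refine ⟨?_, ?_, ?_, ?_⟩
  · refine ContDiffOn.congr (f := fun p => fderiv ℝ (fun p : ℝ × ℝ => u p.1 p.2) p (1, 0))
      (hfd.clm_apply contDiffOn_const) (fun p hp => (hA p hp).deriv)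
  · refine ContDiffOn.congr (f := fun p => fderiv ℝ (fun p : ℝ × ℝ => u p.1 p.2) p (0, 1))
      (hfd.clm_apply contDiffOn_const) (fun p hp => (hB p hp).deriv)
  · exact fun r t h0 h1 => (hA (r, t) ⟨h0, h1⟩).differentiableAt.hasDerivAt
  · exact fun r t h0 h1 => (hB (r, t) ⟨h0, h1⟩).differentiableAt.hasDerivAt

lemma coeff_eq (β : ℝ) (hβ : -1 < β) (u : ℝ → ℝ → ℝ)
    (hper : ∀ ρ θ : ℝ, u ρ (θ + 2 * π) = u ρ θ)
    (hsmooth : ContDiffOn ℝ (⊤ : ℕ∞) (fun p : ℝ × ℝ => u p.1 p.2)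
      {p : ℝ × ℝ | 0 < p.1 ∧ p.1 < 1})
    (M : ℝ) (hbdd : ∀ ρ θ : ℝ, 0 < ρ → ρ < 1 → |u ρ θ| ≤ M)
    (hharm : ∀ ρ θ : ℝ, 0 < ρ → ρ < 1 → coneLap β u ρ θ = 0) (n : ℤ) :
    ∃ A : ℂ, ‖A‖ ≤ M * (2 * π) ∧ ∀ r, 0 < r → r < 1 →
      ∫ t in (0:ℝ)..(2 * π), Complex.exp (-(n * t * Complex.I)) * (u r t : ℂ)
        = A * ((r ^ ((β + 1)⁻¹ * |(n:ℝ)|) : ℝ) : ℂ) := by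
  have hβ1 : 0 < β + 1 := by linarith
  obtain ⟨sr, st, dr, dt⟩ := strip_deriv u hsmooth
  obtain ⟨srr, -, drr, -⟩ := strip_deriv (fun r t => deriv (fun r' => u r' t) r) sr
  obtain ⟨-, stt, -, dtt⟩ := strip_deriv (fun r t => deriv (fun s => u r s) t) st
  set φ : ℝ → ℂ := fun t => Complex.exp (-(n * t * Complex.I)) with hφdef
  have hφ : Continuous φ := by fun_prop
  have hφd : ∀ t, HasDerivAt φ (-(n * Complex.I) * φ t) t := by
    intro t
    have h2 : HasDerivAt (fun r : ℝ => (r:ℂ)) 1 t := by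
      simpa using (hasDerivAt_id t).ofReal_comp
    have := (((h2.const_mul (n:ℂ)).mul_const Complex.I).neg).cexp
    convert! this using 1
    simp [hφdef]; ring
  have hφ2 : φ (2 * π) = φ 0 := by
    simp only [hφdef]
    have : -((n:ℂ) * ((2 * π : ℝ) : ℂ) * Complex.I) = ((-n : ℤ) : ℂ) * (2 * π * Complex.I) := by
      push_cast; ring
    rw [this, Complex.exp_int_mul_two_pi_mul_I]; simp
  have hφn : ∀ t, ‖φ t‖ = 1 := by
    intro t
    have : -((n:ℂ) * t * Complex.I) = ((-(n * t) : ℝ) : ℂ) * Complex.I := by push_cast; ring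
    simp only [hφdef]
    rw [this, Complex.norm_exp_ofReal_mul_I]
  have slice : ∀ v : ℝ → ℝ → ℝ,
      ContinuousOn (fun p : ℝ × ℝ => v p.1 p.2) {p : ℝ × ℝ | 0 < p.1 ∧ p.1 < 1} →
      ∀ r, 0 < r → r < 1 → Continuous (fun t => φ t * (v r t : ℂ)) := by
    intro v hv r h0 h1
    have : Continuous (fun t => v r t) :=
      hv.comp_continuous (f := fun t => (r, t)) (by fun_prop) (fun t => ⟨h0, h1⟩)
    fun_prop
  have hpt : ∀ r, deriv (fun s => u r s) (2 * π) = deriv (fun s => u r s) 0 := by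
    intro r
    have h := deriv_comp_add_const (fun s => u r s) (2 * π) 0
    simp only [hper, zero_add] at h
    exact h.symm
  have ibp : ∀ r, 0 < r → r < 1 →
      (∫ t in (0:ℝ)..(2 * π), φ t * ((deriv (fun s => deriv (fun s' => u r s') s) t : ℝ) : ℂ))
        = -(n:ℂ)^2 * ∫ t in (0:ℝ)..(2 * π), φ t * (u r t : ℂ) := by
    intro r h0 h1
    have i1 := (slice (fun r t => deriv (fun s => deriv (fun s' => u r s') s) t) stt.continuousOn r h0 h1).intervalIntegrable (μ := MeasureTheory.volume) 0 (2*π)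
    have i2 := (slice u hsmooth.continuousOn r h0 h1).intervalIntegrable (μ := MeasureTheory.volume) 0 (2*π)
    have ftc := intervalIntegral.integral_eq_sub_of_hasDerivAt (a := 0) (b := 2 * π)
      (f := fun t => φ t * ((deriv (fun s => u r s) t : ℝ) : ℂ)
        - (-(n * Complex.I) * φ t) * (u r t : ℂ))
      (f' := fun t => φ t * ((deriv (fun s => deriv (fun s' => u r s') s) t : ℝ) : ℂ)
        + (n:ℂ)^2 * (φ t * (u r t : ℂ))) ?_ ?_
    · rw [intervalIntegral.integral_add i1 (i2.const_mul _),
        intervalIntegral.integral_const_mul] at ftc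
      have hu0 : u r (2 * π) = u r 0 := by simpa using hper r 0
      rw [hpt, hφ2, hu0, sub_self] at ftc
      linear_combination ftc
    · intro t _
      have := ((hφd t).mul (dtt r t h0 h1).ofReal_comp).sub
        (((hφd t).const_mul (-(n * Complex.I))).mul (dt r t h0 h1).ofReal_comp)
      convert! this using 1
      linear_combination ((n:ℂ)^2 * (φ t * (u r t : ℂ))) * Complex.I_sq
    · exact i1.add (i2.const_mul _)
  refine euler_ode
    (fun r => ∫ t in (0:ℝ)..(2 * π), φ t * (u r t : ℂ))
    (fun r => ∫ t in (0:ℝ)..(2 * π), φ t * ((deriv (fun r' => u r' t) r : ℝ) : ℂ))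
    (fun r => ∫ t in (0:ℝ)..(2 * π),
      φ t * ((deriv (fun r => deriv (fun r' => u r' t) r) r : ℝ) : ℂ))
    ((β + 1)⁻¹ * |(n:ℝ)|) (M * (2 * π)) (by positivity)
    (fun r h0 h1 => param_deriv u _ φ hφ hsmooth.continuousOn sr.continuousOn dr _ _ r h0 h1)
    (fun r h0 h1 => param_deriv _ _ φ hφ sr.continuousOn srr.continuousOn drr _ _ r h0 h1)
    ?_ ?_
  · intro r h0 h1
    have i1 := (slice (fun r t => deriv (fun r => deriv (fun r' => u r' t) r) r) srr.continuousOn r h0 h1).intervalIntegrable (μ := MeasureTheory.volume) 0 (2*π)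
    have i2 := (slice (fun r t => deriv (fun r' => u r' t) r) sr.continuousOn r h0 h1).intervalIntegrable (μ := MeasureTheory.volume) 0 (2*π)
    have hsq : ((((β + 1)⁻¹ * |(n:ℝ)| : ℝ) : ℂ))^2 = (((β + 1)^2)⁻¹ : ℝ) * (n:ℂ)^2 := by
      have : ((β + 1)⁻¹ * |(n:ℝ)|)^2 = ((β + 1)^2)⁻¹ * (n:ℝ)^2 := by
        rw [mul_pow, sq_abs, inv_pow]
      exact_mod_cast this
    rw [hsq, mul_assoc]
    have := ibp r h0 h1
    have e : (n:ℂ)^2 * ∫ t in (0:ℝ)..(2 * π), φ t * (u r t : ℂ) =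
      -(∫ t in (0:ℝ)..(2 * π), φ t * ((deriv (fun s => deriv (fun s' => u r s') s) t : ℝ) : ℂ)) := by
      rw [this]; ring
    rw [e, ← intervalIntegral.integral_const_mul, ← intervalIntegral.integral_const_mul,
      ← intervalIntegral.integral_add (i1.const_mul _) (i2.const_mul _),
      ← intervalIntegral.integral_neg, ← intervalIntegral.integral_const_mul]
    refine intervalIntegral.integral_congr fun t _ => ?_
    have hh := hharm r t h0 h1
    unfold coneLap at hh
    have h3 : r^2 * deriv (fun r => deriv (fun r' => u r' t) r) r + r * deriv (fun r' => u r' t) r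
        = -(((β + 1)^2)⁻¹ * deriv (fun s => deriv (fun s' => u r s') s) t) := by
      field_simp at hh ⊢
      linarith
    have h4 : (r:ℂ)^2 * ((deriv (fun r => deriv (fun r' => u r' t) r) r : ℝ) : ℂ)
        + r * ((deriv (fun r' => u r' t) r : ℝ) : ℂ)
        = -((((β + 1)^2)⁻¹ : ℝ) * ((deriv (fun s => deriv (fun s' => u r s') s) t : ℝ) : ℂ)) := by
      exact_mod_cast h3
    linear_combination φ t * h4
  · intro r h0 h1
    refine (intervalIntegral.norm_integral_le_of_norm_le_const (C := M) ?_).trans ?_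
    · intro t _
      rw [norm_mul, hφn, one_mul, Complex.norm_real]
      exact hbdd r t h0 h1
    · rw [sub_zero, abs_of_pos (by positivity)]

/-- The complex coordinate. -/
noncomputable def cz (β ρ θ : ℝ) : ℂ := ((ρ ^ (β + 1)⁻¹ : ℝ) : ℂ) * Complex.exp (θ * Complex.I)

lemma norm_cz (β ρ θ : ℝ) (h0 : 0 < ρ) : ‖cz β ρ θ‖ = ρ ^ (β + 1)⁻¹ := by
  rw [cz, norm_mul, Complex.norm_exp_ofReal_mul_I, mul_one, Complex.norm_real, Real.norm_eq_abs,
    abs_of_pos (Real.rpow_pos_of_pos h0 _)]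

lemma norm_cz_lt (β ρ θ : ℝ) (hβ : -1 < β) (h0 : 0 < ρ) (h1 : ρ < 1) : ‖cz β ρ θ‖ < 1 := by
  rw [norm_cz _ _ _ h0]
  exact Real.rpow_lt_one h0.le h1 (inv_pos.2 (by linarith))

lemma cz_pow (β ρ θ : ℝ) (h0 : 0 < ρ) (n : ℕ) :
    cz β ρ θ ^ n = ((ρ ^ ((β + 1)⁻¹ * n) : ℝ) : ℂ) * Complex.exp (n * θ * Complex.I) := by
  rw [cz, mul_pow, ← Complex.exp_nat_mul, Real.rpow_mul h0.le, Real.rpow_natCast]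
  push_cast
  ring_nf

lemma recon (β : ℝ) (hβ : -1 < β) (u : ℝ → ℝ → ℝ)
    (hper : ∀ ρ θ : ℝ, u ρ (θ + 2 * π) = u ρ θ)
    (hsmooth : ContDiffOn ℝ (⊤ : ℕ∞) (fun p : ℝ × ℝ => u p.1 p.2)
      {p : ℝ × ℝ | 0 < p.1 ∧ p.1 < 1})
    (M : ℝ) (hbdd : ∀ ρ θ : ℝ, 0 < ρ → ρ < 1 → |u ρ θ| ≤ M)
    (hharm : ∀ ρ θ : ℝ, 0 < ρ → ρ < 1 → coneLap β u ρ θ = 0) :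
    ∃ (B : ℕ → ℂ) (C : ℝ), (∀ n, ‖B n‖ ≤ C) ∧
      ∀ ρ θ, 0 < ρ → ρ < 1 → HasSum (fun n => (B n * cz β ρ θ ^ n).re) (u ρ θ) := by
  have hβ1 : 0 < β + 1 := by linarith
  have hM0 : 0 ≤ M := (abs_nonneg _).trans (hbdd (1/2) 0 (by norm_num) (by norm_num))
  choose A hA hA' using coeff_eq β hβ u hper hsmooth M hbdd hharm
  let a : ℤ → ℂ := fun n => A n / (2 * π)
  have ha : ∀ n, ‖a n‖ ≤ M := by
    intro n
    have h2 : ‖(2 * π : ℂ)‖ = 2 * π := by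
      have : ‖((2 * π : ℝ) : ℂ)‖ = 2 * π := by
        rw [Complex.norm_real, Real.norm_eq_abs, abs_of_pos (by positivity)]
      simpa using this
    simp only [a]
    rw [norm_div, h2, div_le_iff₀ (by positivity)]
    exact hA n
  refine ⟨fun n => if n = 0 then a 0 else a n + (starRingEnd ℂ) (a (-n)), M + M, ?_, ?_⟩
  · intro n
    dsimp only
    split_ifs
    · linarith [ha 0]
    · refine (norm_add_le _ _).trans ?_
      rw [Complex.norm_conj]
      linarith [ha n, ha (-n)]
  intro ρ θ h0 h1
  have : Fact (0 < 2 * π) := ⟨by positivity⟩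
  have hp : Function.Periodic (fun t => (u ρ t : ℂ)) (2 * π) := fun t => by simp [hper]
  have hcont : Continuous (fun t => (u ρ t : ℂ)) := by
    have : Continuous (fun t => u ρ t) :=
      hsmooth.continuousOn.comp_continuous (f := fun t => (ρ, t)) (by fun_prop) (fun t => ⟨h0, h1⟩)
    fun_prop
  let f : C(AddCircle (2 * π), ℂ) := ⟨hp.lift, hcont.quotient_lift _⟩
  have hfc : ∀ n : ℤ, fourierCoeff f n = a n * ((ρ ^ ((β + 1)⁻¹ * |(n:ℝ)|) : ℝ) : ℂ) := by
    intro n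
    rw [fourierCoeff_eq_intervalIntegral _ _ 0, zero_add]
    have : ∫ x in (0:ℝ)..(2 * π), (fourier (T := 2 * π) (-n) (x : AddCircle (2*π))) • f x =
        ∫ t in (0:ℝ)..(2 * π), Complex.exp (-(n * t * Complex.I)) * (u ρ t : ℂ) := by
      refine intervalIntegral.integral_congr fun t _ => ?_
      simp only [smul_eq_mul]
      rw [fourier_coe_apply]
      congr 2
      have : (π:ℂ) ≠ 0 := by exact_mod_cast Real.pi_ne_zero
      push_cast
      field_simp
    rw [this, hA' n ρ h0 h1, Complex.real_smul]
    simp only [a]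
    push_cast
    ring
  set s : ℝ := ρ ^ (β + 1)⁻¹ with hs
  have hs0 : 0 < s := Real.rpow_pos_of_pos h0 _
  have hs1 : s < 1 := Real.rpow_lt_one h0.le h1 (inv_pos.2 hβ1)
  have hnat : ∀ n : ℕ, ρ ^ ((β + 1)⁻¹ * (n:ℝ)) = s ^ n := by
    intro n; rw [Real.rpow_mul h0.le, Real.rpow_natCast]
  have hg : Summable (fun n : ℕ => M * s ^ n) :=
    (summable_geometric_of_lt_one hs0.le hs1).mul_left M
  have hsum : Summable (fourierCoeff f) := by
    refine Summable.of_nat_of_neg ?_ ?_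
    · refine Summable.of_norm_bounded hg fun n => ?_
      rw [hfc, norm_mul, Complex.norm_real, Int.cast_natCast, Nat.abs_cast, hnat, Real.norm_eq_abs,
        abs_of_pos (by positivity)]
      gcongr
      exact ha _
    · refine Summable.of_norm_bounded hg fun n => ?_
      rw [hfc, norm_mul, Complex.norm_real, Int.cast_neg, abs_neg, Int.cast_natCast, Nat.abs_cast,
        hnat, Real.norm_eq_abs, abs_of_pos (by positivity)]
      gcongr
      exact ha _
  have hS := (has_pointwise_sum_fourier_series_of_summable hsum (θ : AddCircle (2 * π))).nat_add_neg
  have hfour : ∀ n : ℤ, fourier (T := 2 * π) n (θ : AddCircle (2*π))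
      = Complex.exp (n * θ * Complex.I) := by
    intro n
    rw [fourier_coe_apply]
    congr 1
    have : (π:ℂ) ≠ 0 := by exact_mod_cast Real.pi_ne_zero
    push_cast
    field_simp
  have hfθ : f (θ : AddCircle (2 * π)) = (u ρ θ : ℂ) := rfl
  have hS0 := hS.sub (hasSum_ite_eq (0:ℕ)
    (fourierCoeff f 0 • fourier (T := 2 * π) 0 (θ : AddCircle (2*π))))
  rw [add_sub_cancel_right, hfθ] at hS0
  have hre := Complex.hasSum_re hS0
  rw [Complex.ofReal_re] at hre
  convert! hre using 2 with n
  rw [cz_pow _ _ _ h0]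
  rcases eq_or_ne n 0 with rfl | hn
  · simp [hfc]
  · simp only [if_neg hn, hfc, hfour, smul_eq_mul, sub_zero]
    rw [add_mul, Complex.add_re, Complex.add_re]
    congr 1
    · simp [mul_assoc]
    · rw [← Complex.conj_re]
      simp only [map_mul, Complex.conj_conj, ← Complex.exp_conj, Complex.conj_ofReal]
      simp [mul_assoc]

/-- Real parts of `z ^ N * g z` with `g` holomorphic in the unit disc. -/
def DiscRep (β : ℝ) (N : ℕ) (v : ℝ → ℝ → ℝ) : Prop :=
  ∃ g : ℂ → ℂ, DifferentiableOn ℂ g (Metric.ball 0 1) ∧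
    ∀ ρ θ, 0 < ρ → ρ < 1 → v ρ θ = (cz β ρ θ ^ N * g (cz β ρ θ)).re

lemma rep_step (N : ℕ) (g : ℂ → ℂ) (hg : DifferentiableOn ℂ g (Metric.ball 0 1))
    (z : ℝ → ℂ) (x : ℝ) (c : ℂ) (hz : HasDerivAt z (c * z x) x) (hzx : ‖z x‖ < 1) :
    HasDerivAt (fun s => (z s ^ N * g (z s)).re)
      (c * (z x ^ N * (N * g (z x) + z x * deriv g (z x)))).re x := by
  have hmem : Metric.ball (0:ℂ) 1 ∈ nhds (z x) :=
    Metric.isOpen_ball.mem_nhds (by simpa using hzx)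
  have hgd : HasDerivAt g (deriv g (z x)) (z x) := (hg.differentiableAt hmem).hasDerivAt
  have h1 := ((hasDerivAt_pow N (z x)).mul hgd).comp x hz
  have h2 := Complex.reCLM.hasFDerivAt.comp_hasDerivAt x h1
  convert! h2 using 1
  simp only [Complex.reCLM_apply]
  congr 1
  rcases N with _ | N
  · simp; ring
  · simp only [Nat.add_sub_cancel]; push_cast; ring

lemma rep_coef (N : ℕ) (g : ℂ → ℂ) (c : ℂ) (hg : DifferentiableOn ℂ g (Metric.ball 0 1)) :
    DifferentiableOn ℂ (fun z => c * (N * g z + z * deriv g z)) (Metric.ball 0 1) := by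
  have := hg.deriv Metric.isOpen_ball
  fun_prop

lemma rep_theta (β : ℝ) (hβ : -1 < β) (N : ℕ) (v : ℝ → ℝ → ℝ) (h : DiscRep β N v) :
    DiscRep β N (pdTheta v) := by
  obtain ⟨g, hg, hv⟩ := h
  refine ⟨_, rep_coef N g Complex.I hg, fun ρ θ h0 h1 => ?_⟩
  have hz : HasDerivAt (fun s => cz β ρ s) (Complex.I * cz β ρ θ) θ := by
    have h2 : HasDerivAt (fun r : ℝ => (r:ℂ)) 1 θ := by
      simpa using (hasDerivAt_id θ).ofReal_comp
    have := ((h2.mul_const Complex.I).cexp).const_mul ((ρ ^ (β + 1)⁻¹ : ℝ) : ℂ)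
    convert! this using 1
    simp [cz]; ring
  have := rep_step N g hg _ θ Complex.I hz (norm_cz_lt β ρ θ hβ h0 h1)
  have e : (fun s => v ρ s) = fun s => (cz β ρ s ^ N * g (cz β ρ s)).re :=
    funext fun s => hv ρ s h0 h1
  rw [pdTheta, e, this.deriv]
  congr 1; ring

lemma rep_rho (β : ℝ) (hβ : -1 < β) (N : ℕ) (v : ℝ → ℝ → ℝ) (h : DiscRep β N v) :
    DiscRep β N (pdRho v) := by
  obtain ⟨g, hg, hv⟩ := h
  refine ⟨_, rep_coef N g (((β + 1)⁻¹ : ℝ) : ℂ) hg, fun ρ θ h0 h1 => ?_⟩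
  have hz : HasDerivAt (fun r => cz β r θ) ((((β + 1)⁻¹ / ρ : ℝ) : ℂ) * cz β ρ θ) ρ := by
    have := ((Real.hasDerivAt_rpow_const (p := (β + 1)⁻¹) (Or.inl h0.ne')).ofReal_comp).mul_const
      (Complex.exp (θ * Complex.I))
    convert! this using 1
    rw [Real.rpow_sub_one h0.ne', cz]
    push_cast
    ring
  have := rep_step N g hg _ ρ _ hz (norm_cz_lt β ρ θ hβ h0 h1)
  have e : (fun r => v r θ) =ᶠ[nhds ρ] fun r => (cz β r θ ^ N * g (cz β r θ)).re := by
    filter_upwards [Ioo_mem_nhds h0 h1] with r hr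
    exact hv r θ hr.1 hr.2
  rw [pdRho, e.deriv_eq, this.deriv, ← Complex.re_ofReal_mul]
  congr 1
  have hr0 : (ρ:ℂ) ≠ 0 := by exact_mod_cast h0.ne'
  push_cast
  field_simp

lemma rep_bound (β q : ℝ) (hβ : -1 < β) (N : ℕ) (hN : q ≤ (β + 1)⁻¹ * N) (v : ℝ → ℝ → ℝ)
    (h : DiscRep β N v) :
    ∃ C : ℝ, ∀ ρ θ : ℝ, 0 < ρ → ρ < 1 / 2 → |v ρ θ| ≤ C * ρ ^ q := by
  obtain ⟨g, hg, hv⟩ := h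
  have hα : 0 < (β + 1)⁻¹ := inv_pos.2 (by linarith)
  set s : ℝ := (1/2 : ℝ) ^ (β + 1)⁻¹
  have hs1 : s < 1 := Real.rpow_lt_one (by norm_num) (by norm_num) hα
  obtain ⟨C, hC⟩ := (isCompact_closedBall (0:ℂ) s).exists_bound_of_continuousOn
    (hg.continuousOn.mono (Metric.closedBall_subset_ball hs1))
  refine ⟨C, fun ρ θ h0 h1 => ?_⟩
  rw [hv ρ θ h0 (by linarith)]
  refine (Complex.abs_re_le_norm _).trans ?_
  have hzs : ‖g (cz β ρ θ)‖ ≤ C := by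
    refine hC _ ?_
    rw [mem_closedBall_zero_iff, norm_cz _ _ _ h0]
    exact Real.rpow_le_rpow h0.le h1.le hα.le
  rw [norm_mul, norm_pow, norm_cz _ _ _ h0, ← Real.rpow_natCast, ← Real.rpow_mul h0.le, mul_comm]
  have := Real.rpow_le_rpow_of_exponent_ge h0 (by linarith) hN
  have hC0 : 0 ≤ C := (norm_nonneg _).trans hzs
  gcongr

lemma series_diff (B : ℕ → ℂ) (C : ℝ) (hB : ∀ n, ‖B n‖ ≤ C) :
    DifferentiableOn ℂ (fun z => ∑' n, B n * z ^ n) (Metric.ball 0 1) := by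
  have hC0 : 0 ≤ C := (norm_nonneg _).trans (hB 0)
  intro z hz
  rw [mem_ball_zero_iff] at hz
  obtain ⟨r, hzr, hr1⟩ := exists_between hz
  have hr0 : 0 ≤ r := (norm_nonneg z).trans hzr.le
  have := Complex.differentiableOn_tsum_of_summable_norm (U := Metric.ball (0:ℂ) r)
    (F := fun n z => B n * z ^ n) (u := fun n => C * r ^ n)
    ((summable_geometric_of_lt_one hr0 hr1).mul_left C) (fun n => by fun_prop)
    Metric.isOpen_ball (fun n w hw => by
      rw [mem_ball_zero_iff] at hw
      rw [norm_mul, norm_pow]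
      have := hB n
      gcongr)
  exact (this.differentiableAt (Metric.isOpen_ball.mem_nhds (by simpa using hzr))).differentiableWithinAt

lemma expSum_eq (β : ℝ) (B : ℕ → ℂ) (N : ℕ) (ρ θ : ℝ) (h0 : 0 < ρ) :
    expSum β (fun j k l => if j = 0 ∧ k = l ∧ l < N then (B l).re else 0)
      (fun j k l => if j = 0 ∧ k = l ∧ l < N then -(B l).im else 0) ρ θ
      = ∑ n ∈ Finset.range N, (B n * cz β ρ θ ^ n).re := by
  unfold expSum
  have hinj : Function.Injective (fun n : ℕ => ((0, n, n) : ℕ × ℕ × ℕ)) := by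
    intro a b h
    simpa using h
  rw [finsum_eq_sum_of_support_subset (s := (Finset.range N).map ⟨_, hinj⟩), Finset.sum_map]
  · refine Finset.sum_congr rfl fun n hn => ?_
    rw [Finset.mem_range] at hn
    rw [cz_pow _ _ _ h0]
    have e : Complex.exp (n * θ * Complex.I) =
        ((Real.cos (n * θ) : ℝ) : ℂ) + ((Real.sin (n * θ) : ℝ) : ℂ) * Complex.I := by
      rw [Complex.exp_mul_I]; push_cast; rfl
    rw [e]
    simp [hn, Complex.mul_re, Complex.mul_im, -Complex.ofReal_cos, -Complex.ofReal_sin]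
    rw [div_eq_inv_mul]
    ring
  · rintro ⟨j, k, l⟩ hi
    by_contra hcon
    apply hi
    have : ¬ (j = 0 ∧ k = l ∧ l < N) := by
      rintro ⟨rfl, rfl, hl⟩
      exact hcon (by simp [hl])
    simp only [if_neg this]
    ring

/-- every bounded smooth harmonic function on the punctured cone ball
`{0 < ρ < 1}` has an expansion up to order `q` for every `q > 0`. -/
theorem stmt3 (β : ℝ) (hβ : -1 < β) (u : ℝ → ℝ → ℝ)
    (hper : ∀ ρ θ : ℝ, u ρ (θ + 2 * π) = u ρ θ)
    (hsmooth : ContDiffOn ℝ (⊤ : ℕ∞) (fun p : ℝ × ℝ => u p.1 p.2)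
      {p : ℝ × ℝ | 0 < p.1 ∧ p.1 < 1})
    (hbdd : ∃ M : ℝ, ∀ ρ θ : ℝ, 0 < ρ → ρ < 1 → |u ρ θ| ≤ M)
    (hharm : ∀ ρ θ : ℝ, 0 < ρ → ρ < 1 → coneLap β u ρ θ = 0) :
    ∀ q : ℝ, 0 < q → HasExpansion β q u := by
  intro q hq
  obtain ⟨M, hM⟩ := hbdd
  have hβ1 : 0 < β + 1 := by linarith
  obtain ⟨B, C, hBC, hB⟩ := recon β hβ u hper hsmooth M hM hharm
  let N : ℕ := ⌈q * (β + 1)⌉₊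
  refine ⟨fun j k l => if j = 0 ∧ k = l ∧ l < N then (B l).re else 0,
    fun j k l => if j = 0 ∧ k = l ∧ l < N then -(B l).im else 0, ?_, ?_⟩
  · intro j k l hn
    have : ¬ (j = 0 ∧ k = l ∧ l < N) := by
      rintro ⟨rfl, rfl, hl⟩
      refine hn ⟨⟨0, by simp⟩, ?_⟩
      have := Nat.lt_ceil.1 hl
      rw [Nat.cast_zero, mul_zero, zero_add, div_lt_iff₀ hβ1]
      exact this
    simp only [if_neg this, and_self]
  · have hrep : DiscRep β N (fun ρ θ => u ρ θ - expSum β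
        (fun j k l => if j = 0 ∧ k = l ∧ l < N then (B l).re else 0)
        (fun j k l => if j = 0 ∧ k = l ∧ l < N then -(B l).im else 0) ρ θ) := by
      refine ⟨_, series_diff (fun n => B (n + N)) C (fun n => hBC _), fun ρ θ h0 h1 => ?_⟩
      dsimp only
      rw [expSum_eq β B N ρ θ h0]
      have hz := norm_cz_lt β ρ θ hβ h0 h1
      have hsm : Summable (fun n => B n * cz β ρ θ ^ n) := by
        refine Summable.of_norm_bounded
          ((summable_geometric_of_lt_one (norm_nonneg _) hz).mul_left C) fun n => ?_
        rw [norm_mul, norm_pow]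
        have := hBC n
        gcongr
      have e1 : u ρ θ = (∑' n, B n * cz β ρ θ ^ n).re :=
        (hB ρ θ h0 h1).unique (Complex.hasSum_re hsm.hasSum)
      rw [e1, ← hsm.sum_add_tsum_nat_add N, Complex.add_re, Complex.re_sum, add_sub_cancel_left,
        ← tsum_mul_left]
      congr 2
      funext n
      ring
    intro k₁ k₂
    refine rep_bound β q hβ N ?_ _ ?_
    · have := Nat.le_ceil (q * (β + 1))
      rw [← div_eq_inv_mul, le_div_iff₀ hβ1]
      exact this
    · have h2 : ∀ k v, DiscRep β N v → DiscRep β N (pdTheta^[k] v) := by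
        intro k
        induction k with
        | zero => exact fun v h => h
        | succ k ih => exact fun v h => ih _ (rep_theta β hβ N v h)
      have h1 : ∀ k v, DiscRep β N v → DiscRep β N (pdRho^[k] v) := by
        intro k
        induction k with
        | zero => exact fun v h => h
        | succ k ih => exact fun v h => ih _ (rep_rho β hβ N v h)
      exact h1 _ _ (h2 _ _ hrep)
end

section
/- Let β > −1 and q ≥ 0. If f₁ and f₂ are smooth functions on {0 < ρ < 1/2} (2π-periodic in θ) that both have expansions up to order q, then f₁ + f₂, f₁ − f₂, f₁ · f₂ and e^{f₁} all have expansions up to order q; more generally, F∘f₁ has an expansion up to order q for every smooth function F : ℝ → ℝ. -/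
open Real

/-- the strip -/
def strip : Set (ℝ × ℝ) := {p : ℝ × ℝ | 0 < p.1 ∧ p.1 < 1 / 2}

/-- smooth on the strip -/
def Sm (u : ℝ → ℝ → ℝ) : Prop := ContDiffOn ℝ (⊤ : ℕ∞) (fun p : ℝ × ℝ => u p.1 p.2) strip

/-- equality on the strip -/
def EqU (u v : ℝ → ℝ → ℝ) : Prop := ∀ ρ θ : ℝ, 0 < ρ → ρ < 1 / 2 → u ρ θ = v ρ θ

lemma isOpen_strip : IsOpen strip :=
  (isOpen_lt continuous_const continuous_fst).inter (isOpen_lt continuous_fst continuous_const)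

lemma EqU.symm {u v : ℝ → ℝ → ℝ} (h : EqU u v) : EqU v u :=
  fun ρ θ h1 h2 => (h ρ θ h1 h2).symm

lemma EqU.trans {u v w : ℝ → ℝ → ℝ} (h : EqU u v) (h' : EqU v w) : EqU u w :=
  fun ρ θ h1 h2 => (h ρ θ h1 h2).trans (h' ρ θ h1 h2)

lemma EqU.pdRho {u v : ℝ → ℝ → ℝ} (h : EqU u v) : EqU (pdRho u) (pdRho v) := by
  intro ρ θ h1 h2
  unfold _root_.pdRho
  congr 1
  apply Filter.EventuallyEq.deriv_eq
  filter_upwards [Ioo_mem_nhds h1 h2] with r hr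
  exact h r θ hr.1 hr.2

lemma EqU.pdTheta {u v : ℝ → ℝ → ℝ} (h : EqU u v) : EqU (pdTheta u) (pdTheta v) := by
  intro ρ θ h1 h2
  unfold _root_.pdTheta
  congr 1
  funext s
  exact h ρ s h1 h2

lemma EqU.sm {u v : ℝ → ℝ → ℝ} (h : EqU u v) (hu : Sm u) : Sm v :=
  ContDiffOn.congr hu (fun p hp => (h p.1 p.2 hp.1 hp.2).symm)

lemma Sm.diffAt {u : ℝ → ℝ → ℝ} (hu : Sm u) {ρ θ : ℝ} (h1 : 0 < ρ) (h2 : ρ < 1 / 2) :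
    DifferentiableAt ℝ (fun p : ℝ × ℝ => u p.1 p.2) (ρ, θ) :=
  (ContDiffOn.contDiffAt hu (isOpen_strip.mem_nhds ⟨h1, h2⟩)).differentiableAt (by simp)

lemma Sm.hasRho {u : ℝ → ℝ → ℝ} (hu : Sm u) {ρ θ : ℝ} (h1 : 0 < ρ) (h2 : ρ < 1 / 2) :
    HasDerivAt (fun r => u r θ) (fderiv ℝ (fun p : ℝ × ℝ => u p.1 p.2) (ρ, θ) (1, 0)) ρ := by
  have h := (hu.diffAt (θ := θ) h1 h2).hasFDerivAt
  have h' : HasDerivAt (fun r : ℝ => (r, θ)) ((1 : ℝ), (0 : ℝ)) ρ :=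
    (hasDerivAt_id ρ).prodMk (hasDerivAt_const ρ θ)
  exact h.comp_hasDerivAt ρ h'

lemma Sm.hasTheta {u : ℝ → ℝ → ℝ} (hu : Sm u) {ρ θ : ℝ} (h1 : 0 < ρ) (h2 : ρ < 1 / 2) :
    HasDerivAt (fun s => u ρ s) (fderiv ℝ (fun p : ℝ × ℝ => u p.1 p.2) (ρ, θ) (0, 1)) θ := by
  have h := (hu.diffAt (θ := θ) h1 h2).hasFDerivAt
  have h' : HasDerivAt (fun s : ℝ => (ρ, s)) ((0 : ℝ), (1 : ℝ)) θ :=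
    (hasDerivAt_const θ ρ).prodMk (hasDerivAt_id θ)
  exact h.comp_hasDerivAt θ h'

lemma Sm.fd {u : ℝ → ℝ → ℝ} (hu : Sm u) :
    ContDiffOn ℝ (⊤ : ℕ∞) (fderiv ℝ (fun p : ℝ × ℝ => u p.1 p.2)) strip :=
  ((contDiffOn_infty_iff_fderiv_of_isOpen isOpen_strip).1 hu).2

lemma Sm.pdRho {u : ℝ → ℝ → ℝ} (hu : Sm u) : Sm (pdRho u) := by
  have h : ContDiffOn ℝ (⊤ : ℕ∞)
      (fun p : ℝ × ℝ => p.1 * fderiv ℝ (fun p : ℝ × ℝ => u p.1 p.2) p (1, 0)) strip :=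
    contDiff_fst.contDiffOn.mul (hu.fd.clm_apply contDiffOn_const)
  refine h.congr fun p hp => ?_
  simp only [_root_.pdRho]
  rw [(hu.hasRho hp.1 hp.2).deriv]

lemma Sm.pdTheta {u : ℝ → ℝ → ℝ} (hu : Sm u) : Sm (pdTheta u) := by
  have h : ContDiffOn ℝ (⊤ : ℕ∞)
      (fun p : ℝ × ℝ => fderiv ℝ (fun p : ℝ × ℝ => u p.1 p.2) p (0, 1)) strip :=
    hu.fd.clm_apply contDiffOn_const
  refine h.congr fun p hp => ?_
  simp only [_root_.pdTheta]
  rw [(hu.hasTheta hp.1 hp.2).deriv]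

lemma pd_comm {u : ℝ → ℝ → ℝ} (hu : Sm u) : EqU (pdTheta (pdRho u)) (pdRho (pdTheta u)) := by
  intro ρ θ h1 h2
  set f : ℝ × ℝ → ℝ := fun p : ℝ × ℝ => u p.1 p.2 with hf
  have hdd : DifferentiableAt ℝ (fderiv ℝ f) (ρ, θ) :=
    (hu.fd.contDiffAt (isOpen_strip.mem_nhds ⟨h1, h2⟩)).differentiableAt (by simp)
  have hs : IsSymmSndFDerivAt ℝ f (ρ, θ) :=
    (ContDiffOn.contDiffAt hu (isOpen_strip.mem_nhds ⟨h1, h2⟩)).isSymmSndFDerivAt (by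
      simp only [minSmoothness_of_isRCLikeNormedField]
      exact WithTop.coe_le_coe.2 (le_top (a := (2 : ℕ∞))))
  have e1 : ∀ w : ℝ × ℝ, HasDerivAt (fun s : ℝ => fderiv ℝ f (ρ, s) w)
      (fderiv ℝ (fderiv ℝ f) (ρ, θ) (0, 1) w) θ := by
    intro w
    have h' : HasDerivAt (fun s : ℝ => (ρ, s)) ((0 : ℝ), (1 : ℝ)) θ :=
      (hasDerivAt_const θ ρ).prodMk (hasDerivAt_id θ)
    have := hdd.hasFDerivAt.comp_hasDerivAt θ h'
    simpa using this.clm_apply (hasDerivAt_const θ w)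
  have e2 : ∀ w : ℝ × ℝ, HasDerivAt (fun r : ℝ => fderiv ℝ f (r, θ) w)
      (fderiv ℝ (fderiv ℝ f) (ρ, θ) (1, 0) w) ρ := by
    intro w
    have h' : HasDerivAt (fun r : ℝ => (r, θ)) ((1 : ℝ), (0 : ℝ)) ρ :=
      (hasDerivAt_id ρ).prodMk (hasDerivAt_const ρ θ)
    have := hdd.hasFDerivAt.comp_hasDerivAt ρ h'
    simpa using this.clm_apply (hasDerivAt_const ρ w)
  have a1 : EqU (pdRho u) (fun ρ θ => ρ * fderiv ℝ f (ρ, θ) (1, 0)) := by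
    intro ρ θ h1 h2
    simp only [pdRho]
    rw [(hu.hasRho h1 h2).deriv]
  have a2 : EqU (pdTheta u) (fun ρ θ => fderiv ℝ f (ρ, θ) (0, 1)) := by
    intro ρ θ h1 h2
    simp only [pdTheta]
    rw [(hu.hasTheta h1 h2).deriv]
  rw [a1.pdTheta ρ θ h1 h2, a2.pdRho ρ θ h1 h2]
  simp only [pdTheta, pdRho]
  rw [((e1 (1, 0)).const_mul ρ).deriv, (e2 (0, 1)).deriv, hs.eq]

/-- zeroth order bound -/
def BB0 (q : ℝ) (u : ℝ → ℝ → ℝ) : Prop :=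
  Sm u ∧ ∃ C : ℝ, ∀ ρ θ : ℝ, 0 < ρ → ρ < 1 / 2 → |u ρ θ| ≤ C * ρ ^ q

/-- bounds on derivatives up to order `n` -/
def BB : ℕ → ℝ → (ℝ → ℝ → ℝ) → Prop
  | 0, q, u => BB0 q u
  | n + 1, q, u => BB0 q u ∧ BB n q (pdRho u) ∧ BB n q (pdTheta u)

lemma BB.bb0 {n : ℕ} {q : ℝ} {u : ℝ → ℝ → ℝ} (h : BB n q u) : BB0 q u := by
  cases n with
  | zero => exact h
  | succ n => exact h.1

lemma BB0.congr {q : ℝ} {u v : ℝ → ℝ → ℝ} (e : EqU u v) (h : BB0 q u) : BB0 q v := by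
  obtain ⟨hs, C, hC⟩ := h
  refine ⟨e.sm hs, C, fun ρ θ h1 h2 => ?_⟩
  rw [← e ρ θ h1 h2]
  exact hC ρ θ h1 h2

lemma BB.congr {n : ℕ} {q : ℝ} {u v : ℝ → ℝ → ℝ} (e : EqU u v) (h : BB n q u) : BB n q v := by
  induction n generalizing u v with
  | zero => exact BB0.congr e h
  | succ n ih => exact ⟨BB0.congr e h.1, ih e.pdRho h.2.1, ih e.pdTheta h.2.2⟩

lemma BB.pred {n : ℕ} {q : ℝ} {u : ℝ → ℝ → ℝ} (h : BB (n + 1) q u) : BB n q u := by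
  induction n generalizing u with
  | zero => exact h.1
  | succ n ih => exact ⟨h.1, ih h.2.1, ih h.2.2⟩

lemma rpow_anti {ρ q r : ℝ} (h1 : 0 < ρ) (h2 : ρ < 1 / 2) (h : q ≤ r) : ρ ^ r ≤ ρ ^ q :=
  Real.rpow_le_rpow_of_exponent_ge h1 (by linarith) h

lemma BB.mono {n : ℕ} {q r : ℝ} {u : ℝ → ℝ → ℝ} (hqr : q ≤ r) (h : BB n r u) : BB n q u := by
  have key : ∀ u, BB0 r u → BB0 q u := by
    rintro u ⟨hs, C, hC⟩
    refine ⟨hs, |C|, fun ρ θ h1 h2 => (hC ρ θ h1 h2).trans ?_⟩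
    have := rpow_anti h1 h2 hqr
    have h3 := Real.rpow_pos_of_pos h1 r
    exact mul_le_mul (le_abs_self C) this h3.le (abs_nonneg C)
  induction n generalizing u with
  | zero => exact key u h
  | succ n ih => exact ⟨key u h.1, ih h.2.1, ih h.2.2⟩

lemma Sm.add {u v : ℝ → ℝ → ℝ} (hu : Sm u) (hv : Sm v) : Sm (u + v) := ContDiffOn.add hu hv
lemma Sm.mul {u v : ℝ → ℝ → ℝ} (hu : Sm u) (hv : Sm v) : Sm (u * v) := ContDiffOn.mul hu hv
lemma Sm.zero : Sm 0 := contDiffOn_const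
lemma Sm.comp {u : ℝ → ℝ → ℝ} (hu : Sm u) {F : ℝ → ℝ} (hF : ContDiff ℝ (⊤ : ℕ∞) F) :
    Sm (fun ρ θ => F (u ρ θ)) := hF.comp_contDiffOn hu

lemma pdRho_add {u v : ℝ → ℝ → ℝ} (hu : Sm u) (hv : Sm v) :
    EqU (pdRho u + pdRho v) (pdRho (u + v)) := by
  intro ρ θ h1 h2
  have := ((hu.hasRho (θ := θ) h1 h2).add (hv.hasRho (θ := θ) h1 h2)).deriv
  simp only [pdRho, Pi.add_apply]
  rw [(hu.hasRho h1 h2).deriv, (hv.hasRho h1 h2).deriv, ← mul_add, ← this]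
  rfl

lemma pdTheta_add {u v : ℝ → ℝ → ℝ} (hu : Sm u) (hv : Sm v) :
    EqU (pdTheta u + pdTheta v) (pdTheta (u + v)) := by
  intro ρ θ h1 h2
  have := ((hu.hasTheta (θ := θ) h1 h2).add (hv.hasTheta (θ := θ) h1 h2)).deriv
  simp only [pdTheta, Pi.add_apply]
  rw [(hu.hasTheta h1 h2).deriv, (hv.hasTheta h1 h2).deriv, ← this]
  rfl

lemma pdRho_mul {u v : ℝ → ℝ → ℝ} (hu : Sm u) (hv : Sm v) :
    EqU (pdRho u * v + u * pdRho v) (pdRho (u * v)) := by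
  intro ρ θ h1 h2
  have := ((hu.hasRho (θ := θ) h1 h2).mul (hv.hasRho (θ := θ) h1 h2)).deriv
  have h3 : pdRho (u * v) ρ θ = ρ * deriv ((fun r => u r θ) * (fun r => v r θ)) ρ := rfl
  rw [h3, this]
  simp only [pdRho, Pi.add_apply, Pi.mul_apply]
  rw [(hu.hasRho h1 h2).deriv, (hv.hasRho h1 h2).deriv]
  ring

lemma pdTheta_mul {u v : ℝ → ℝ → ℝ} (hu : Sm u) (hv : Sm v) :
    EqU (pdTheta u * v + u * pdTheta v) (pdTheta (u * v)) := by
  intro ρ θ h1 h2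
  have := ((hu.hasTheta (θ := θ) h1 h2).mul (hv.hasTheta (θ := θ) h1 h2)).deriv
  have h3 : pdTheta (u * v) ρ θ = deriv ((fun r => u ρ r) * (fun r => v ρ r)) θ := rfl
  rw [h3, this]
  simp only [pdTheta, Pi.add_apply, Pi.mul_apply]
  rw [(hu.hasTheta h1 h2).deriv, (hv.hasTheta h1 h2).deriv]

lemma pdRho_comp {u : ℝ → ℝ → ℝ} (hu : Sm u) {F : ℝ → ℝ} (hF : ContDiff ℝ (⊤ : ℕ∞) F) :
    EqU ((fun ρ θ => deriv F (u ρ θ)) * pdRho u) (pdRho (fun ρ θ => F (u ρ θ))) := by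
  intro ρ θ h1 h2
  have hd : HasDerivAt F (deriv F (u ρ θ)) (u ρ θ) :=
    (hF.differentiable (by simp) _).hasDerivAt
  have := (hd.comp ρ (hu.hasRho (θ := θ) h1 h2)).deriv
  have h3 : pdRho (fun ρ θ => F (u ρ θ)) ρ θ = ρ * deriv (F ∘ (fun r => u r θ)) ρ := rfl
  rw [h3, this]
  simp only [pdRho, Pi.mul_apply]
  rw [(hu.hasRho h1 h2).deriv]
  ring

lemma pdTheta_comp {u : ℝ → ℝ → ℝ} (hu : Sm u) {F : ℝ → ℝ} (hF : ContDiff ℝ (⊤ : ℕ∞) F) :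
    EqU ((fun ρ θ => deriv F (u ρ θ)) * pdTheta u) (pdTheta (fun ρ θ => F (u ρ θ))) := by
  intro ρ θ h1 h2
  have hd : HasDerivAt F (deriv F (u ρ θ)) (u ρ θ) :=
    (hF.differentiable (by simp) _).hasDerivAt
  have := (hd.comp θ (hu.hasTheta (θ := θ) h1 h2)).deriv
  have h3 : pdTheta (fun ρ θ => F (u ρ θ)) ρ θ = deriv (F ∘ (fun r => u ρ r)) θ := rfl
  rw [h3, this]
  simp only [pdTheta, Pi.mul_apply]
  rw [(hu.hasTheta h1 h2).deriv]

lemma BB0.add {q : ℝ} {u v : ℝ → ℝ → ℝ} (hu : BB0 q u) (hv : BB0 q v) : BB0 q (u + v) := by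
  obtain ⟨hs, C, hC⟩ := hu
  obtain ⟨hs', C', hC'⟩ := hv
  refine ⟨hs.add hs', C + C', fun ρ θ h1 h2 => ?_⟩
  have := abs_add_le (u ρ θ) (v ρ θ)
  have a := hC ρ θ h1 h2
  have b := hC' ρ θ h1 h2
  simp only [Pi.add_apply]
  linarith

lemma BB.add {n : ℕ} {q : ℝ} {u v : ℝ → ℝ → ℝ} (hu : BB n q u) (hv : BB n q v) :
    BB n q (u + v) := by
  induction n generalizing u v with
  | zero => exact BB0.add hu hv
  | succ n ih =>
    exact ⟨BB0.add hu.1 hv.1, (ih hu.2.1 hv.2.1).congr (pdRho_add hu.1.1 hv.1.1),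
      (ih hu.2.2 hv.2.2).congr (pdTheta_add hu.1.1 hv.1.1)⟩

lemma BB0.mul {q r : ℝ} {u v : ℝ → ℝ → ℝ} (hu : BB0 q u) (hv : BB0 r v) :
    BB0 (q + r) (u * v) := by
  obtain ⟨hs, C, hC⟩ := hu
  obtain ⟨hs', C', hC'⟩ := hv
  refine ⟨hs.mul hs', C * C', fun ρ θ h1 h2 => ?_⟩
  have a := hC ρ θ h1 h2
  have b := hC' ρ θ h1 h2
  simp only [Pi.mul_apply]
  rw [abs_mul, Real.rpow_add h1]
  calc _ ≤ (C * ρ ^ q) * (C' * ρ ^ r) :=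
        mul_le_mul a b (abs_nonneg _) ((abs_nonneg _).trans a)
    _ = _ := by ring

lemma BB.mul {n : ℕ} {q r : ℝ} {u v : ℝ → ℝ → ℝ} (hu : BB n q u) (hv : BB n r v) :
    BB n (q + r) (u * v) := by
  induction n generalizing u v with
  | zero => exact BB0.mul hu hv
  | succ n ih =>
    exact ⟨BB0.mul hu.1 hv.1,
      ((ih hu.2.1 hv.pred).add (ih hu.pred hv.2.1)).congr (pdRho_mul hu.1.1 hv.1.1),
      ((ih hu.2.2 hv.pred).add (ih hu.pred hv.2.2)).congr (pdTheta_mul hu.1.1 hv.1.1)⟩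

lemma BB.zero (n : ℕ) (q : ℝ) : BB n q 0 := by
  have key : BB0 q 0 := ⟨Sm.zero, 0, fun ρ θ h1 h2 => by simp⟩
  have e1 : pdRho 0 = 0 := by funext ρ θ; simp [pdRho]
  have e2 : pdTheta 0 = 0 := by funext ρ θ; simp [pdTheta]
  induction n with
  | zero => exact key
  | succ n ih => exact ⟨key, by rwa [e1], by rwa [e2]⟩

/-- the general monomial -/
noncomputable def mono (s l a b : ℝ) : ℝ → ℝ → ℝ :=
  fun ρ θ => a * ρ ^ s * Real.cos (l * θ) + b * ρ ^ s * Real.sin (l * θ)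

lemma mono_sm (s l a b : ℝ) : Sm (mono s l a b) := by
  have h : ContDiffOn ℝ (⊤ : ℕ∞) (fun p : ℝ × ℝ => p.1 ^ s) strip := by
    intro p hp
    exact (contDiff_fst.contDiffAt.rpow_const_of_ne hp.1.ne').contDiffWithinAt
  have hc : ContDiff ℝ (⊤ : ℕ∞) (fun p : ℝ × ℝ => Real.cos (l * p.2)) := by fun_prop
  have hs : ContDiff ℝ (⊤ : ℕ∞) (fun p : ℝ × ℝ => Real.sin (l * p.2)) := by fun_prop
  exact ((contDiffOn_const.mul h).mul hc.contDiffOn).add ((contDiffOn_const.mul h).mul hs.contDiffOn)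

lemma mono_BB (n : ℕ) (s l a b : ℝ) : BB n s (mono s l a b) := by
  have key : ∀ a b, BB0 s (mono s l a b) := by
    intro a b
    refine ⟨mono_sm s l a b, |a| + |b|, fun ρ θ h1 h2 => ?_⟩
    have h3 := Real.rpow_pos_of_pos h1 s
    unfold mono
    refine (abs_add_le _ _).trans ?_
    rw [abs_mul, abs_mul, abs_mul, abs_mul, abs_of_pos h3, add_mul]
    exact add_le_add (mul_le_of_le_one_right (by positivity) (Real.abs_cos_le_one _))
      (mul_le_of_le_one_right (by positivity) (Real.abs_sin_le_one _))
  induction n generalizing a b with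
  | zero => exact key a b
  | succ n ih =>
    refine ⟨key a b, (ih (s * a) (s * b)).congr ?_, (ih (l * b) (- (l * a))).congr ?_⟩
    · intro ρ θ h1 h2
      have h : HasDerivAt (fun r : ℝ => r ^ s) (s * ρ ^ (s - 1)) ρ :=
        Real.hasDerivAt_rpow_const (Or.inl h1.ne')
      have h' := ((h.const_mul a).mul_const (Real.cos (l * θ))).add
        ((h.const_mul b).mul_const (Real.sin (l * θ)))
      have h3 : pdRho (mono s l a b) ρ θ = ρ * _ := congrArg (fun x => ρ * x) h'.deriv
      rw [h3, Real.rpow_sub h1, Real.rpow_one]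
      unfold mono
      field_simp
    · intro ρ θ h1 h2
      have h0 : HasDerivAt (fun x : ℝ => l * x) l θ := by
        simpa using (hasDerivAt_id θ).const_mul l
      have h' := ((h0.cos).const_mul (a * ρ ^ s)).add ((h0.sin).const_mul (b * ρ ^ s))
      have h3 : pdTheta (mono s l a b) ρ θ = _ := h'.deriv
      rw [h3]
      unfold mono
      ring

/-- the module of functions which are `Otilde q` -/
def W (q : ℝ) : Submodule ℝ (ℝ → ℝ → ℝ) where
  carrier := {u | ∀ n, BB n q u}
  add_mem' := fun hu hv n => (hu n).add (hv n)
  zero_mem' := fun n => BB.zero n q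
  smul_mem' := fun c u hu n => by
    have h := (mono_BB n 0 0 c 0).mul (hu n)
    rw [zero_add] at h
    refine h.congr fun ρ θ h1 h2 => ?_
    simp [mono]

lemma mem_W {q : ℝ} {u : ℝ → ℝ → ℝ} : u ∈ W q ↔ ∀ n, BB n q u := Iff.rfl

lemma W_congr {q : ℝ} {u v : ℝ → ℝ → ℝ} (e : EqU u v) (hu : u ∈ W q) : v ∈ W q :=
  fun n => (hu n).congr e

lemma W_anti {q r : ℝ} (h : q ≤ r) : W r ≤ W q := fun _ hu n => (hu n).mono h

lemma W_sm {q : ℝ} {u : ℝ → ℝ → ℝ} (hu : u ∈ W q) : Sm u := (hu 0).1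

lemma iter_comm (a : ℕ) {u : ℝ → ℝ → ℝ} (hu : Sm u) :
    Sm (pdRho^[a] u) ∧ EqU (pdRho^[a] (pdTheta u)) (pdTheta (pdRho^[a] u)) := by
  induction a generalizing u with
  | zero => exact ⟨hu, fun _ _ _ _ => rfl⟩
  | succ a ih =>
    have h := ih hu
    rw [Function.iterate_succ_apply', Function.iterate_succ_apply']
    exact ⟨h.1.pdRho, h.2.pdRho.trans (pd_comm h.1).symm⟩

lemma iterTheta_sm (b : ℕ) {u : ℝ → ℝ → ℝ} (hu : Sm u) : Sm (pdTheta^[b] u) := by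
  induction b with
  | zero => exact hu
  | succ a ih => rw [Function.iterate_succ_apply']; exact ih.pdTheta

lemma W_iff {q : ℝ} {u : ℝ → ℝ → ℝ} (hu : Sm u) : u ∈ W q ↔ Otilde q u := by
  constructor
  · intro h k₁ k₂
    have h1 : ∀ b n, BB n q (pdTheta^[b] u) := by
      intro b
      induction b with
      | zero => exact h
      | succ b ih => intro n; rw [Function.iterate_succ_apply']; exact (ih (n + 1)).2.2
    have h2 : ∀ a n, BB n q (pdRho^[a] (pdTheta^[k₂] u)) := by
      intro b
      induction b with
      | zero => exact h1 k₂
      | succ b ih => intro n; rw [Function.iterate_succ_apply']; exact (ih (n + 1)).2.1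
    exact (h2 k₁ 0).2
  · intro h n
    have key : ∀ n a b, BB n q (pdRho^[a] (pdTheta^[b] u)) := by
      intro n
      have k0 : ∀ a b, BB0 q (pdRho^[a] (pdTheta^[b] u)) :=
        fun a b => ⟨(iter_comm a (iterTheta_sm b hu)).1, h a b⟩
      induction n with
      | zero => exact k0
      | succ n ih =>
        intro a b
        refine ⟨k0 a b, ?_, ?_⟩
        · rw [← Function.iterate_succ_apply' pdRho]; exact ih (a + 1) b
        · have := ih a (b + 1)
          rw [Function.iterate_succ_apply'] at this
          exact this.congr (iter_comm a (iterTheta_sm b hu)).2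
    exact key n 0 0

/-- vanishing to order `N` at the origin -/
def Van : ℕ → (ℝ → ℝ) → Prop
  | 0, _ => True
  | N + 1, H => H 0 = 0 ∧ Van N (deriv H)

lemma exists_antideriv (P : Polynomial ℝ) (c : ℝ) :
    ∃ Q : Polynomial ℝ, Polynomial.derivative Q = P ∧ Q.eval 0 = c := by
  have h : ∃ Q : Polynomial ℝ, Polynomial.derivative Q = P := by
    induction P using Polynomial.induction_on' with
    | add p q hp hq =>
      obtain ⟨Q, hQ⟩ := hp
      obtain ⟨R, hR⟩ := hq
      exact ⟨Q + R, by rw [Polynomial.derivative_add, hQ, hR]⟩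
    | monomial n a =>
      refine ⟨Polynomial.monomial (n + 1) (a / (n + 1)), ?_⟩
      rw [Polynomial.derivative_monomial]
      have : ((n : ℝ) + 1) ≠ 0 := by positivity
      congr 1
      push_cast
      field_simp
  obtain ⟨Q, hQ⟩ := h
  exact ⟨Q + Polynomial.C (c - Q.eval 0), by simp [hQ], by simp⟩

lemma smooth_deriv {F : ℝ → ℝ} (hF : ContDiff ℝ (⊤ : ℕ∞) F) : ContDiff ℝ (⊤ : ℕ∞) (deriv F) :=
  (contDiff_infty_iff_deriv.1 hF).2

lemma exists_van (N : ℕ) {F : ℝ → ℝ} (hF : ContDiff ℝ (⊤ : ℕ∞) F) :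
    ∃ P : Polynomial ℝ, Van N (fun x => F x - P.eval x) := by
  induction N generalizing F with
  | zero => exact ⟨0, trivial⟩
  | succ N ih =>
    obtain ⟨P, hP⟩ := ih (smooth_deriv hF)
    obtain ⟨Q, hQ, hQ0⟩ := exists_antideriv P (F 0)
    refine ⟨Q, by simp [hQ0], ?_⟩
    have : deriv (fun x => F x - Q.eval x) = fun x => deriv F x - P.eval x := by
      funext x
      have h1 : HasDerivAt F (deriv F x) x := (hF.differentiable (by simp) _).hasDerivAt
      have h2 := Q.hasDerivAt x
      rw [hQ] at h2
      exact (h1.sub h2).deriv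
    rw [this]
    exact hP

lemma van_bound (N : ℕ) {H : ℝ → ℝ} (hH : ContDiff ℝ (⊤ : ℕ∞) H) (hv : Van N H) (M : ℝ) :
    ∃ C, 0 ≤ C ∧ ∀ x, |x| ≤ M → |H x| ≤ C * |x| ^ N := by
  induction N generalizing H with
  | zero =>
    obtain ⟨C, hC⟩ := (isCompact_Icc (a := -M) (b := M)).exists_bound_of_continuousOn
      hH.continuous.continuousOn
    refine ⟨|C|, abs_nonneg _, fun x hx => ?_⟩
    have := hC x (abs_le.1 hx)
    rw [Real.norm_eq_abs] at this
    simpa using this.trans (le_abs_self C)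
  | succ N ih =>
    obtain ⟨C, hC0, hC⟩ := ih (smooth_deriv hH) hv.2
    refine ⟨C, hC0, fun x hx => ?_⟩
    have := (convex_Icc (-|x|) |x|).norm_image_sub_le_of_norm_deriv_le (f := H) (x := 0) (y := x)
      (C := C * |x| ^ N) (fun y _ => hH.differentiable (by simp) y) (fun y hy => by
        have hy' : |y| ≤ |x| := abs_le.2 hy
        rw [Real.norm_eq_abs]
        refine (hC y (hy'.trans hx)).trans ?_
        gcongr) ⟨by simp, by simp⟩ ⟨neg_abs_le x, le_abs_self x⟩
    rw [hv.1, sub_zero, sub_zero, Real.norm_eq_abs, Real.norm_eq_abs] at this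
    rw [pow_succ, ← mul_assoc]
    exact this

lemma van_BB (n : ℕ) {e : ℝ} (he : 0 ≤ e) {g : ℝ → ℝ → ℝ} (hg : g ∈ W e) (N : ℕ) {H : ℝ → ℝ}
    (hH : ContDiff ℝ (⊤ : ℕ∞) H) (hv : Van N H) : BB n (N * e) (fun ρ θ => H (g ρ θ)) := by
  have key : ∀ (N : ℕ) (H : ℝ → ℝ), ContDiff ℝ (⊤ : ℕ∞) H → Van N H →
      BB0 (N * e) (fun ρ θ => H (g ρ θ)) := by
    intro N H hH hv
    refine ⟨(W_sm hg).comp hH, ?_⟩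
    obtain ⟨-, D, hD⟩ := hg 0
    obtain ⟨C, hC0, hC⟩ := van_bound N hH hv |D|
    refine ⟨C * |D| ^ N, fun ρ θ h1 h2 => ?_⟩
    have hr := Real.rpow_pos_of_pos h1 e
    have hr1 : ρ ^ e ≤ 1 := Real.rpow_le_one h1.le (by linarith) he
    have hb : |g ρ θ| ≤ |D| * ρ ^ e :=
      (hD ρ θ h1 h2).trans (mul_le_mul_of_nonneg_right (le_abs_self D) hr.le)
    refine (hC _ (hb.trans (mul_le_of_le_one_right (abs_nonneg D) hr1))).trans ?_
    have h4 : ρ ^ ((N : ℝ) * e) = (ρ ^ e) ^ N := by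
      rw [mul_comm, Real.rpow_mul h1.le, Real.rpow_natCast]
    rw [h4, mul_assoc, ← mul_pow]
    gcongr
  induction n generalizing N H with
  | zero => exact key N H hH hv
  | succ n ih =>
    have hd : ∀ v, BB n e v → BB n (N * e) ((fun ρ θ => deriv H (g ρ θ)) * v) := by
      intro v hvv
      cases N with
      | zero =>
        have := (ih 0 (smooth_deriv hH) trivial).mul hvv
        refine this.mono ?_
        simpa using he
      | succ N =>
        have := (ih N (smooth_deriv hH) hv.2).mul hvv
        refine this.mono (le_of_eq ?_)
        push_cast
        ring
    exact ⟨key N H hH hv, (hd _ (hg (n + 1)).2.1).congr (pdRho_comp (W_sm hg) hH),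
      (hd _ (hg (n + 1)).2.2).congr (pdTheta_comp (W_sm hg) hH)⟩

lemma W_mul {q r : ℝ} {u v : ℝ → ℝ → ℝ} (hu : u ∈ W q) (hv : v ∈ W r) : u * v ∈ W (q + r) :=
  fun n => (hu n).mul (hv n)

/-- the exponent -/
noncomputable def ex (β : ℝ) (j k : ℕ) : ℝ := 2 * (j : ℝ) + (k : ℝ) / (β + 1)

/-- generators -/
def G (β q : ℝ) : Set (ℝ → ℝ → ℝ) :=
  {u | ∃ j k l : ℕ, ∃ a b : ℝ, goodIdx β q j k l ∧ u = mono (ex β j k) l a b}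

/-- functions with an expansion -/
def MM (β q : ℝ) : Submodule ℝ (ℝ → ℝ → ℝ) := Submodule.span ℝ (G β q) ⊔ W q

lemma ex_nonneg {β : ℝ} (hβ : -1 < β) (j k : ℕ) : 0 ≤ ex β j k := by
  have : 0 < β + 1 := by linarith
  unfold ex
  positivity

lemma MM_congr {β q : ℝ} {u v : ℝ → ℝ → ℝ} (e : EqU u v) (hu : u ∈ MM β q) : v ∈ MM β q := by
  have h0 : v - u ∈ W q := W_congr (u := 0) (fun ρ θ h1 h2 => by
    simp [e ρ θ h1 h2]) (W q).zero_mem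
  have : v = u + (v - u) := by abel
  rw [this]
  exact (MM β q).add_mem hu ((le_sup_right : W q ≤ MM β q) h0)

lemma mono_mem {β q : ℝ} {j k l : ℕ} (h : ∃ m : ℕ, k = l + 2 * m) (a b : ℝ) :
    mono (ex β j k) l a b ∈ MM β q := by
  by_cases hq : ex β j k < q
  · exact (le_sup_left : _ ≤ MM β q) (Submodule.subset_span ⟨j, k, l, a, b, ⟨h, hq⟩, rfl⟩)
  · exact (le_sup_right : _ ≤ MM β q) (W_anti (not_lt.1 hq) (fun n => mono_BB n _ _ _ _))

lemma mono_mem_int {β q : ℝ} {j k : ℕ} {l : ℤ} (h : ∃ m : ℕ, k = l.natAbs + 2 * m) (a b : ℝ) :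
    mono (ex β j k) l a b ∈ MM β q := by
  rcases Int.natAbs_eq l with hl | hl
  · have := mono_mem (β := β) (q := q) (j := j) h a b
    have e : (l : ℝ) = (l.natAbs : ℝ) := by
      have := congrArg (Int.cast : ℤ → ℝ) hl
      rwa [Int.cast_natCast] at this
    rw [e]
    exact this
  · have := mono_mem (β := β) (q := q) (j := j) h a (-b)
    have e : mono (ex β j k) l a b = mono (ex β j k) l.natAbs a (-b) := by
      funext ρ θ
      have : (l : ℝ) = - (l.natAbs : ℝ) := by exact_mod_cast hl
      simp only [mono]
      rw [this]
      simp [neg_mul, Real.cos_neg, Real.sin_neg]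
    rw [e]
    exact this

lemma ex_add (β : ℝ) (j k j' k' : ℕ) : ex β (j + j') (k + k') = ex β j k + ex β j' k' := by
  unfold ex; push_cast; ring

lemma G_mul {β q : ℝ} {u v : ℝ → ℝ → ℝ} (hu : u ∈ G β q) (hv : v ∈ G β q) : u * v ∈ MM β q := by
  obtain ⟨j, k, l, a, b, ⟨⟨m, hm⟩, -⟩, rfl⟩ := hu
  obtain ⟨j', k', l', a', b', ⟨⟨m', hm'⟩, -⟩, rfl⟩ := hv
  have h1 : mono (ex β (j + j') (k + k')) ((l + l' : ℤ) : ℝ) ((a * a' - b * b') / 2)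
      ((a * b' + b * a') / 2) ∈ MM β q :=
    mono_mem_int ⟨m + m', by omega⟩ _ _
  have h2 : mono (ex β (j + j') (k + k')) ((l - l' : ℤ) : ℝ) ((a * a' + b * b') / 2)
      ((b * a' - a * b') / 2) ∈ MM β q := by
    apply mono_mem_int
    rcases le_total l l' with h | h
    · exact ⟨m + m' + l, by omega⟩
    · exact ⟨m + m' + l', by omega⟩
  refine MM_congr ?_ ((MM β q).add_mem h1 h2)
  intro ρ θ hρ _
  simp only [mono, Pi.add_apply, Pi.mul_apply, ex_add]
  rw [Real.rpow_add hρ]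
  push_cast
  rw [add_mul, sub_mul, Real.cos_add, Real.cos_sub, Real.sin_add, Real.sin_sub]
  ring

lemma MM_le {β q : ℝ} (hβ : -1 < β) (hq : 0 ≤ q) : MM β q ≤ W 0 := by
  refine sup_le (Submodule.span_le.2 ?_) (W_anti hq)
  rintro u ⟨j, k, l, a, b, -, rfl⟩
  exact W_anti (ex_nonneg hβ j k) (fun n => mono_BB n _ _ _ _)

open scoped Pointwise in
lemma MM_mul {β q : ℝ} (hβ : -1 < β) (hq : 0 ≤ q) {u v : ℝ → ℝ → ℝ} (hu : u ∈ MM β q)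
    (hv : v ∈ MM β q) : u * v ∈ MM β q := by
  have hv0 := MM_le hβ hq hv
  obtain ⟨p, hp, r, hr, rfl⟩ := Submodule.mem_sup.1 hu
  obtain ⟨p', hp', r', hr', rfl⟩ := Submodule.mem_sup.1 hv
  have hp0 : p ∈ W 0 := MM_le hβ hq ((le_sup_left : _ ≤ MM β q) hp)
  have e : (p + r) * (p' + r') = p * p' + (r * (p' + r') + p * r') := by ring
  rw [e]
  refine (MM β q).add_mem ?_ ((le_sup_right : _ ≤ MM β q) ((W q).add_mem ?_ ?_))
  · have : p * p' ∈ Submodule.span ℝ (G β q * G β q) := by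
      rw [← Submodule.span_mul_span]
      exact Submodule.mul_mem_mul hp hp'
    refine Submodule.span_le.2 ?_ this
    rintro _ ⟨x, hx, y, hy, rfl⟩
    exact G_mul hx hy
  · simpa using W_mul hr hv0
  · simpa using W_mul hp0 hr'

lemma MM_one {β q : ℝ} : (1 : ℝ → ℝ → ℝ) ∈ MM β q := by
  have := mono_mem (β := β) (q := q) (j := 0) (k := 0) (l := 0) ⟨0, rfl⟩ 1 0
  refine MM_congr ?_ this
  intro ρ θ _ _
  simp [mono, ex]

lemma MM_aeval {β q : ℝ} (hβ : -1 < β) (hq : 0 ≤ q) {g : ℝ → ℝ → ℝ} (hg : g ∈ MM β q)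
    (P : Polynomial ℝ) : (fun ρ θ => P.eval (g ρ θ)) ∈ MM β q := by
  induction P using Polynomial.induction_on' with
  | add p r hp hr =>
    have := (MM β q).add_mem hp hr
    convert this using 1
    funext ρ θ
    simp
  | monomial n a =>
    have h : g ^ n ∈ MM β q := by
      induction n with
      | zero => simpa using MM_one
      | succ n ih => rw [pow_succ]; exact MM_mul hβ hq ih hg
    have := (MM β q).smul_mem a h
    convert this using 1
    funext ρ θ
    simp

lemma MM_split {β q : ℝ} (hβ : -1 < β) (hq : 0 < q) :
    ∃ e : ℝ, 0 < e ∧ ∀ f ∈ MM β q, ∃ c : ℝ, f - c • 1 ∈ W e := by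
  have hb : 0 < 1 / (β + 1) := by
    have : 0 < β + 1 := by linarith
    positivity
  refine ⟨min q (min 2 (1 / (β + 1))), by positivity, fun f hf => ?_⟩
  set e := min q (min 2 (1 / (β + 1))) with he
  obtain ⟨p, hp, r, hr, rfl⟩ := Submodule.mem_sup.1 hf
  have hr' : r ∈ W e := W_anti (min_le_left _ _) hr
  have : ∃ c : ℝ, p - c • 1 ∈ W e := by
    clear hf
    induction hp using Submodule.span_induction with
    | zero => exact ⟨0, by simp⟩
    | add x y _ _ hx hy =>
      obtain ⟨c, hc⟩ := hx
      obtain ⟨d, hd⟩ := hy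
      refine ⟨c + d, ?_⟩
      have := (W e).add_mem hc hd
      convert this using 1
      rw [add_smul]; abel
    | smul a x _ hx =>
      obtain ⟨c, hc⟩ := hx
      refine ⟨a * c, ?_⟩
      have := (W e).smul_mem a hc
      convert this using 1
      rw [smul_sub, smul_smul]
    | mem x hx =>
      obtain ⟨j, k, l, a, b, ⟨⟨m, hm⟩, -⟩, rfl⟩ := hx
      by_cases h0 : j = 0 ∧ k = 0
      · obtain ⟨rfl, rfl⟩ := h0
        have hl : l = 0 := by omega
        subst hl
        refine ⟨a, W_congr (u := 0) (fun ρ θ _ _ => ?_) (W e).zero_mem⟩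
        simp [mono, ex]
      · refine ⟨0, ?_⟩
        rw [zero_smul, sub_zero]
        refine W_anti ?_ (fun n => mono_BB n _ _ _ _)
        have hb1 : 0 < β + 1 := by linarith
        have hkk : 0 ≤ (k : ℝ) / (β + 1) := by positivity
        unfold ex
        by_cases hj : j = 0
        · have hk : 1 ≤ k := by omega
          have hk' : (1 : ℝ) ≤ k := by exact_mod_cast hk
          have : 1 / (β + 1) ≤ (k : ℝ) / (β + 1) := by gcongr
          have h3 : e ≤ 1 / (β + 1) := (min_le_right _ _).trans (min_le_right _ _)
          have : (0 : ℝ) ≤ j := Nat.cast_nonneg j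
          linarith
        · have hj1 : 1 ≤ j := by omega
          have hj' : (1 : ℝ) ≤ j := by exact_mod_cast hj1
          have h3 : e ≤ 2 := (min_le_right _ _).trans (min_le_left _ _)
          linarith
  obtain ⟨c, hc⟩ := this
  refine ⟨c, ?_⟩
  have := (W e).add_mem hc hr'
  convert this using 1
  abel

lemma MM_comp {β q : ℝ} (hβ : -1 < β) (hq : 0 ≤ q) {f : ℝ → ℝ → ℝ} (hf : f ∈ MM β q)
    {F : ℝ → ℝ} (hF : ContDiff ℝ (⊤ : ℕ∞) F) : (fun ρ θ => F (f ρ θ)) ∈ MM β q := by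
  rcases hq.eq_or_lt with h0 | hpos
  · subst h0
    refine (le_sup_right : _ ≤ MM β 0) (fun n => ?_)
    have := van_BB n le_rfl (MM_le hβ le_rfl hf) 0 hF trivial
    simpa using this
  · obtain ⟨e, he, hsplit⟩ := MM_split hβ hpos
    obtain ⟨c, hc⟩ := hsplit f hf
    have hg : f - c • 1 ∈ MM β q := (MM β q).sub_mem hf ((MM β q).smul_mem c MM_one)
    set g := f - c • (1 : ℝ → ℝ → ℝ) with hgdef
    obtain ⟨N, hN⟩ := exists_nat_ge (q / e)
    have hN' : q ≤ N * e := (div_le_iff₀ he).1 hN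
    have hF' : ContDiff ℝ (⊤ : ℕ∞) (fun x => F (c + x)) := hF.comp (contDiff_const.add contDiff_id)
    obtain ⟨P, hP⟩ := exists_van N hF'
    have hH : ContDiff ℝ (⊤ : ℕ∞) (fun x => F (c + x) - P.eval x) := by
      refine hF'.sub ?_
      simpa using P.contDiff_aeval (𝕜 := ℝ) (⊤ : ℕ∞)
    have h1 : (fun ρ θ => (fun x => F (c + x) - P.eval x) (g ρ θ)) ∈ W q :=
      W_anti hN' (fun n => van_BB n he.le hc N hH hP)
    have h2 := (MM β q).add_mem (MM_aeval hβ hq hg P) ((le_sup_right : _ ≤ MM β q) h1)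
    convert h2 using 1
    funext ρ θ
    simp [hgdef]

lemma good_finite {β : ℝ} (hβ : -1 < β) (q : ℝ) :
    {i : ℕ × ℕ × ℕ | goodIdx β q i.1 i.2.1 i.2.2}.Finite := by
  have hb1 : 0 < β + 1 := by linarith
  obtain ⟨J, hJ⟩ := exists_nat_ge q
  obtain ⟨K, hK⟩ := exists_nat_ge (q * (β + 1))
  refine ((Set.finite_Iic J).prod ((Set.finite_Iic K).prod (Set.finite_Iic K))).subset ?_
  rintro ⟨j, k, l⟩ ⟨⟨m, hm⟩, hlt⟩
  simp only at hm hlt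
  have hkk : 0 ≤ (k : ℝ) / (β + 1) := by positivity
  have hjj : (0 : ℝ) ≤ j := Nat.cast_nonneg j
  have h1 : j ≤ J := by
    have : (j : ℝ) ≤ J := by linarith
    exact_mod_cast this
  have h2 : k ≤ K := by
    have h3 : (k : ℝ) / (β + 1) ≤ q := by linarith
    have : (k : ℝ) ≤ K := ((div_le_iff₀ hb1).1 h3).trans hK
    exact_mod_cast this
  exact ⟨h1, h2, (by omega : l ≤ k).trans h2⟩

/-- admissible coefficients -/
def Adm (β q : ℝ) (a b : ℕ → ℕ → ℕ → ℝ) : Prop :=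
  ∀ j k l : ℕ, ¬ goodIdx β q j k l → a j k l = 0 ∧ b j k l = 0

lemma expSum_eq_s4 {β q : ℝ} (hβ : -1 < β) {a b : ℕ → ℕ → ℕ → ℝ} (h : Adm β q a b) :
    expSum β a b = ∑ i ∈ (good_finite hβ q).toFinset,
      mono (ex β i.1 i.2.1) i.2.2 (a i.1 i.2.1 i.2.2) (b i.1 i.2.1 i.2.2) := by
  funext ρ θ
  unfold expSum
  rw [finsum_eq_sum_of_support_subset (s := (good_finite hβ q).toFinset)]
  · simp [Finset.sum_apply, mono, ex]
  · intro i hi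
    by_contra hn
    apply hi
    have hn' : ¬ goodIdx β q i.1 i.2.1 i.2.2 := by simpa using hn
    simp [h _ _ _ hn']

lemma expSum_mem {β q : ℝ} (hβ : -1 < β) {a b : ℕ → ℕ → ℕ → ℝ} (h : Adm β q a b) :
    expSum β a b ∈ Submodule.span ℝ (G β q) := by
  rw [expSum_eq_s4 hβ h]
  refine Submodule.sum_mem _ fun i hi => Submodule.subset_span ?_
  exact ⟨i.1, i.2.1, i.2.2, _, _, by simpa using hi, rfl⟩

lemma span_exp {β q : ℝ} (hβ : -1 < β) {p : ℝ → ℝ → ℝ} (hp : p ∈ Submodule.span ℝ (G β q)) :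
    ∃ a b, Adm β q a b ∧ p = expSum β a b := by
  induction hp using Submodule.span_induction with
  | zero =>
    refine ⟨fun _ _ _ => 0, fun _ _ _ => 0, fun _ _ _ _ => ⟨rfl, rfl⟩, ?_⟩
    funext ρ θ
    simp [expSum]
  | add x y _ _ hx hy =>
    obtain ⟨a, b, h, rfl⟩ := hx
    obtain ⟨a', b', h', rfl⟩ := hy
    have hA : Adm β q (fun j k l => a j k l + a' j k l) (fun j k l => b j k l + b' j k l) := by
      intro j k l hn
      simp [h _ _ _ hn, h' _ _ _ hn]
    refine ⟨_, _, hA, ?_⟩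
    rw [expSum_eq_s4 hβ h, expSum_eq_s4 hβ h', expSum_eq_s4 hβ hA, ← Finset.sum_add_distrib]
    refine Finset.sum_congr rfl fun i _ => ?_
    funext ρ θ
    simp only [mono, Pi.add_apply]
    ring
  | smul c x _ hx =>
    obtain ⟨a, b, h, rfl⟩ := hx
    have hA : Adm β q (fun j k l => c * a j k l) (fun j k l => c * b j k l) := by
      intro j k l hn
      simp [h _ _ _ hn]
    refine ⟨_, _, hA, ?_⟩
    rw [expSum_eq_s4 hβ h, expSum_eq_s4 hβ hA, Finset.smul_sum]
    refine Finset.sum_congr rfl fun i _ => ?_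
    funext ρ θ
    simp only [mono, Pi.smul_apply, smul_eq_mul]
    ring
  | mem x hx =>
    obtain ⟨j, k, l, a, b, hg, rfl⟩ := hx
    classical
    have hA : Adm β q (fun j' k' l' => if (j', k', l') = (j, k, l) then a else 0)
        (fun j' k' l' => if (j', k', l') = (j, k, l) then b else 0) := by
      intro j' k' l' hn
      have : (j', k', l') ≠ (j, k, l) := by
        intro he
        simp only [Prod.mk.injEq] at he
        obtain ⟨rfl, rfl, rfl⟩ := he
        exact hn hg
      simp only [if_neg this, and_self]
    refine ⟨_, _, hA, ?_⟩
    rw [expSum_eq_s4 hβ hA, Finset.sum_eq_single (j, k, l)]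
    · simp
    · intro i _ hi
      have : (i.1, i.2.1, i.2.2) ≠ (j, k, l) := hi
      simp only [if_neg this]
      funext ρ θ
      simp [mono]
    · intro hn
      exact absurd hg (by simpa using hn)

lemma hasExp_iff {β q : ℝ} (hβ : -1 < β) (hq : 0 ≤ q) {u : ℝ → ℝ → ℝ} (hu : Sm u) :
    HasExpansion β q u ↔ u ∈ MM β q := by
  have hsm : ∀ a b, Adm β q a b → Sm (fun ρ θ => u ρ θ - expSum β a b ρ θ) := by
    intro a b h
    have : Sm (expSum β a b) := W_sm (MM_le hβ hq ((le_sup_left : _ ≤ MM β q) (expSum_mem hβ h)))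
    exact ContDiffOn.sub hu this
  constructor
  · rintro ⟨a, b, h, hO⟩
    have := (W_iff (hsm a b h)).2 hO
    have h2 := (MM β q).add_mem ((le_sup_left : _ ≤ MM β q) (expSum_mem hβ h))
      ((le_sup_right : _ ≤ MM β q) this)
    convert h2 using 1
    funext ρ θ
    simp
  · intro h
    obtain ⟨p, hp, r, hr, rfl⟩ := Submodule.mem_sup.1 h
    obtain ⟨a, b, hA, rfl⟩ := span_exp hβ hp
    refine ⟨a, b, hA, (W_iff (hsm a b hA)).1 ?_⟩
    convert hr using 1
    funext ρ θ
    simp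

/-- if `f₁`, `f₂` are smooth on `{0 < ρ < 1/2}` and have expansions up to
order `q`, so do `f₁ + f₂`, `f₁ - f₂`, `f₁ · f₂`, `e^{f₁}` and, more generally,
`F ∘ f₁` for any smooth `F : ℝ → ℝ`. -/
theorem stmt4 (β q : ℝ) (hβ : -1 < β) (hq : 0 ≤ q) (f₁ f₂ : ℝ → ℝ → ℝ)
    (h₁smooth : ContDiffOn ℝ (⊤ : ℕ∞) (fun p : ℝ × ℝ => f₁ p.1 p.2)
      {p : ℝ × ℝ | 0 < p.1 ∧ p.1 < 1 / 2})
    (h₂smooth : ContDiffOn ℝ (⊤ : ℕ∞) (fun p : ℝ × ℝ => f₂ p.1 p.2)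
      {p : ℝ × ℝ | 0 < p.1 ∧ p.1 < 1 / 2})
    (h₁per : ∀ ρ θ : ℝ, f₁ ρ (θ + 2 * π) = f₁ ρ θ)
    (h₂per : ∀ ρ θ : ℝ, f₂ ρ (θ + 2 * π) = f₂ ρ θ)
    (h₁ : HasExpansion β q f₁) (h₂ : HasExpansion β q f₂) :
    HasExpansion β q (fun ρ θ => f₁ ρ θ + f₂ ρ θ) ∧
    HasExpansion β q (fun ρ θ => f₁ ρ θ - f₂ ρ θ) ∧
    HasExpansion β q (fun ρ θ => f₁ ρ θ * f₂ ρ θ) ∧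
    HasExpansion β q (fun ρ θ => Real.exp (f₁ ρ θ)) ∧
    (∀ F : ℝ → ℝ, ContDiff ℝ (⊤ : ℕ∞) F → HasExpansion β q (fun ρ θ => F (f₁ ρ θ))) := by
  have s₁ : Sm f₁ := h₁smooth
  have s₂ : Sm f₂ := h₂smooth
  have m₁ := (hasExp_iff hβ hq s₁).1 h₁
  have m₂ := (hasExp_iff hβ hq s₂).1 h₂
  have back : ∀ u, u ∈ MM β q → HasExpansion β q u :=
    fun u hu => (hasExp_iff hβ hq (W_sm (MM_le hβ hq hu))).2 hu
  exact ⟨back _ ((MM β q).add_mem m₁ m₂), back _ ((MM β q).sub_mem m₁ m₂),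
    back _ (MM_mul hβ hq m₁ m₂), back _ (MM_comp hβ hq m₁ Real.contDiff_exp),
    fun F hF => back _ (MM_comp hβ hq m₁ hF)⟩
end

section
/- Let β > −1, let l be a nonnegative integer, set c = l/(β+1), let q ≥ 0, and let L_l = ∂²/∂ρ² + ρ⁻¹ d/dρ − c²ρ⁻². Suppose a_* : (0,1] → ℝ is smooth and for every nonnegative integer k₁ there is a constant C₁(k₁) with |(ρ d/dρ)^{k₁} a_*(ρ)| ≤ C₁(k₁) ρ^q for all ρ ∈ (0,1]. If −c + 2 + q ≠ 0, then there exists a smooth function A_* : (0,1] → ℝ with L_l A_* = a_* on (0,1] and, for every nonnegative integer k₁, a constant C₂(k₁) depending only on k₁, q, c and C₁(0),…,C₁(k₁), such that |(ρ d/dρ)^{k₁} A_*(ρ)| ≤ C₂(k₁) ρ^{q+2} for all ρ ∈ (0,1]. -/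
open Real Set

/-- The operator `ρ d/dρ` on functions of `ρ ∈ (0,1]` (derivative taken within `(0,1]`,
so that it is the one-sided derivative at `ρ = 1`). -/
noncomputable def rd (A : ℝ → ℝ) : ℝ → ℝ :=
  fun ρ => ρ * derivWithin A (Set.Ioc 0 1) ρ

/-- The `l`-th Fourier-mode operator of the cone Laplacian,
`L_l A = A'' + ρ⁻¹ A' - c² ρ⁻² A` with `c = l/(β+1)`, derivatives taken within `(0,1]`. -/
noncomputable def Lop (c : ℝ) (A : ℝ → ℝ) (ρ : ℝ) : ℝ :=
  derivWithin (fun r => derivWithin A (Set.Ioc 0 1) r) (Set.Ioc 0 1) ρ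
    + ρ⁻¹ * derivWithin A (Set.Ioc 0 1) ρ
    - c ^ 2 * (ρ ^ 2)⁻¹ * A ρ

lemma uD : UniqueDiffOn ℝ (Set.Ioc (0:ℝ) 1) := uniqueDiffOn_Ioc 0 1

lemma rd_congr {f g : ℝ → ℝ} (h : EqOn f g (Ioc 0 1)) : EqOn (rd f) (rd g) (Ioc 0 1) := by
  intro x hx
  simp only [rd]
  rw [derivWithin_congr h (h hx)]

lemma rd_iter_congr (k : ℕ) : ∀ {f g : ℝ → ℝ}, EqOn f g (Ioc 0 1) →
    EqOn (rd^[k] f) (rd^[k] g) (Ioc 0 1) := by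
  induction k with
  | zero => intro f g h; simpa using h
  | succ k ih =>
    intro f g h
    simp only [Function.iterate_succ, Function.comp]
    exact ih (rd_congr h)

lemma rd_smooth {f : ℝ → ℝ} (h : ContDiffOn ℝ (⊤ : ℕ∞) f (Ioc 0 1)) :
    ContDiffOn ℝ (⊤ : ℕ∞) (rd f) (Ioc 0 1) := by
  unfold rd
  exact contDiffOn_id.mul ((contDiffOn_infty_iff_derivWithin uD).1 h).2

lemma smooth_hd {f : ℝ → ℝ} (h : ContDiffOn ℝ (⊤ : ℕ∞) f (Ioc 0 1)) {x : ℝ} (hx : x ∈ Ioc (0:ℝ) 1) :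
    HasDerivWithinAt f (x⁻¹ * rd f x) (Ioc 0 1) x := by
  have := (((contDiffOn_infty_iff_derivWithin uD).1 h).1 x hx).hasDerivWithinAt
  have e : x⁻¹ * rd f x = derivWithin f (Ioc 0 1) x := inv_mul_cancel_left₀ hx.1.ne' _
  rw [e]
  exact this

lemma rd_of_hd {f : ℝ → ℝ} {d x : ℝ} (hx : x ∈ Ioc (0:ℝ) 1)
    (h : HasDerivWithinAt f d (Ioc 0 1) x) : rd f x = x * d := by
  simp only [rd]; rw [h.derivWithin (uD x hx)]

lemma rd_lin {f g : ℝ → ℝ} (s : ℝ) (hf : ContDiffOn ℝ (⊤ : ℕ∞) f (Ioc 0 1))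
    (hg : ContDiffOn ℝ (⊤ : ℕ∞) g (Ioc 0 1)) :
    EqOn (rd (fun x => s * f x + g x)) (fun x => s * rd f x + rd g x) (Ioc 0 1) := by
  intro x hx
  have := hx.1.ne'
  refine (rd_of_hd hx (((smooth_hd hf hx).const_mul s).add (smooth_hd hg hx))).trans ?_
  field_simp

lemma lin_smooth {f g : ℝ → ℝ} (s : ℝ) (hf : ContDiffOn ℝ (⊤ : ℕ∞) f (Ioc 0 1))
    (hg : ContDiffOn ℝ (⊤ : ℕ∞) g (Ioc 0 1)) :
    ContDiffOn ℝ (⊤ : ℕ∞) (fun x => s * f x + g x) (Ioc 0 1) :=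
  (contDiffOn_const.mul hf).add hg

lemma rd_iter_lin (k : ℕ) : ∀ {f g : ℝ → ℝ} (s : ℝ), ContDiffOn ℝ (⊤ : ℕ∞) f (Ioc 0 1) →
    ContDiffOn ℝ (⊤ : ℕ∞) g (Ioc 0 1) →
    EqOn (rd^[k] (fun x => s * f x + g x)) (fun x => s * rd^[k] f x + rd^[k] g x) (Ioc 0 1) := by
  induction k with
  | zero => intro f g s _ _ x _; simp
  | succ k ih =>
    intro f g s hf hg x hx
    simp only [Function.iterate_succ, Function.comp]
    rw [rd_iter_congr k (rd_lin s hf hg) hx]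
    exact ih s (rd_smooth hf) (rd_smooth hg) hx

lemma sq_bound (q : ℝ) (k : ℕ) : ∀ C : ℕ → ℝ, ∃ K : ℝ, ∀ a : ℝ → ℝ,
    ContDiffOn ℝ (⊤ : ℕ∞) a (Ioc 0 1) →
    (∀ j : ℕ, ∀ ρ ∈ Ioc (0:ℝ) 1, |rd^[j] a ρ| ≤ C j * ρ ^ q) →
    ∀ ρ ∈ Ioc (0:ℝ) 1, |rd^[k] (fun x => x ^ 2 * a x) ρ| ≤ K * ρ ^ (q + 2) := by
  induction k with
  | zero =>
    intro C
    refine ⟨C 0, fun a _ h ρ hρ => ?_⟩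
    have h0 := h 0 ρ hρ
    simp only [Function.iterate_zero, id] at h0 ⊢
    rw [Real.rpow_add hρ.1, Real.rpow_two, abs_mul, abs_of_nonneg (sq_nonneg ρ)]
    nlinarith [sq_nonneg ρ]
  | succ k ih =>
    intro C
    obtain ⟨K, hK⟩ := ih (fun j => 2 * C j + C (j + 1))
    refine ⟨K, fun a ha h ρ hρ => ?_⟩
    have key := hK (fun x => 2 * a x + rd a x) (lin_smooth 2 ha (rd_smooth ha)) ?_ ρ hρ
    · simp only [Function.iterate_succ, Function.comp]
      rw [rd_iter_congr k (g := fun x => x ^ 2 * (2 * a x + rd a x)) _ hρ]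
      · exact key
      · intro x hx
        have := hx.1.ne'
        refine (rd_of_hd hx (((hasDerivWithinAt_id x _).pow 2).mul (smooth_hd ha hx))).trans ?_
        simp
        field_simp
    · intro j x hx
      rw [rd_iter_lin j 2 ha (rd_smooth ha) hx]
      have h1 := h j x hx
      have h2 := h (j+1) x hx
      simp only [Function.iterate_succ, Function.comp] at h2
      calc _ ≤ |2 * rd^[j] a x| + |rd^[j] (rd a) x| := abs_add_le _ _
        _ = 2 * |rd^[j] a x| + |rd^[j] (rd a) x| := by rw [abs_mul]; norm_num
        _ ≤ _ := by linarith

/-- antiderivative with bound -/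
lemma antideriv (t C : ℝ) (ht : t ≠ 0) (g : ℝ → ℝ) (hg : ContinuousOn g (Ioc 0 1))
    (hb : ∀ ρ ∈ Ioc (0:ℝ) 1, |g ρ| ≤ C * ρ ^ (t - 1)) :
    ∃ F : ℝ → ℝ, (∀ ρ ∈ Ioc (0:ℝ) 1, HasDerivWithinAt F (g ρ) (Ioc 0 1) ρ) ∧
      ∀ ρ ∈ Ioc (0:ℝ) 1, |F ρ| ≤ C / |t| * ρ ^ t := by
  have hC : 0 ≤ C := by
    have := hb 1 ⟨one_pos, le_rfl⟩
    simp at this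
    exact (abs_nonneg _).trans this
  set G : ℝ → ℝ := fun r => g (min r 1) with hG
  have hGc : ContinuousOn G (Ioi 0) := by
    apply hg.comp (by fun_prop)
    intro x hx
    exact ⟨lt_min hx one_pos, min_le_right _ _⟩
  have hGg : ∀ x ∈ Ioc (0:ℝ) 1, G x = g x := fun x hx => by simp [hG, min_eq_left hx.2]
  have main : ∀ z : ℝ, (∀ ρ ∈ Ioc (0:ℝ) 1, IntervalIntegrable G MeasureTheory.volume z ρ) →
      ∀ ρ ∈ Ioc (0:ℝ) 1, HasDerivWithinAt (fun x => ∫ r in z..x, G r) (g ρ) (Ioc 0 1) ρ := by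
    intro z hz ρ hρ
    rw [← hGg ρ hρ]
    apply HasDerivAt.hasDerivWithinAt
    apply intervalIntegral.integral_hasDerivAt_right (hz ρ hρ)
    · exact hGc.stronglyMeasurableAtFilter isOpen_Ioi ρ hρ.1
    · exact hGc.continuousAt (Ioi_mem_nhds hρ.1)
  rcases lt_or_gt_of_ne ht with h | h
  · refine ⟨_, main 1 ?_, ?_⟩
    · intro ρ hρ
      apply ContinuousOn.intervalIntegrable
      apply hGc.mono
      intro x hx
      rw [uIcc_of_ge hρ.2] at hx
      exact hρ.1.trans_le hx.1
    · intro ρ hρ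
      have hn : (0:ℝ) ∉ uIcc ρ 1 := by
        rw [uIcc_of_le hρ.2]; intro h0; exact absurd h0.1 (not_le.2 hρ.1)
      have hi : IntervalIntegrable (fun x : ℝ => C * x ^ (t-1)) MeasureTheory.volume ρ 1 :=
        (intervalIntegral.intervalIntegrable_rpow (Or.inr hn)).const_mul C
      have := intervalIntegral.norm_integral_le_of_norm_le (f := G) hρ.2
        (Filter.Eventually.of_forall (fun x hx => ?_)) hi
      · rw [intervalIntegral.integral_symm, abs_neg]
        refine (this : |_| ≤ _).trans ?_
        rw [intervalIntegral.integral_const_mul, integral_rpow (Or.inr ⟨by intro h'; apply ht; linarith, hn⟩)]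
        simp only [sub_add_cancel, Real.one_rpow]
        rw [abs_of_neg h, div_mul_eq_mul_div, ← mul_div_assoc, ← neg_div_neg_eq]
        apply div_le_div_of_nonneg_right _ (by linarith)
        linarith
      · have hx' : x ∈ Ioc (0:ℝ) 1 := ⟨hρ.1.trans hx.1, hx.2⟩
        rw [hGg x hx']; exact hb x hx'
  · have hi : ∀ ρ : ℝ, IntervalIntegrable (fun x : ℝ => C * x ^ (t-1)) MeasureTheory.volume 0 ρ :=
      fun ρ => (intervalIntegral.intervalIntegrable_rpow' (by linarith)).const_mul C
    have hbd : ∀ ρ ∈ Ioc (0:ℝ) 1, ∀ x ∈ Ioc 0 ρ, ‖G x‖ ≤ C * x ^ (t-1) := by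
      intro ρ hρ x hx
      have hx' : x ∈ Ioc (0:ℝ) 1 := ⟨hx.1, hx.2.trans hρ.2⟩
      rw [hGg x hx']; exact hb x hx'
    refine ⟨_, main 0 ?_, ?_⟩
    · intro ρ hρ
      apply (hi ρ).mono_fun'
      · apply ContinuousOn.aestronglyMeasurable _ measurableSet_uIoc
        apply hGc.mono
        rw [uIoc_of_le hρ.1.le]
        exact fun x hx => hx.1
      · rw [uIoc_of_le hρ.1.le]
        exact (MeasureTheory.ae_restrict_iff' measurableSet_Ioc).2
          (Filter.Eventually.of_forall (hbd ρ hρ))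
    · intro ρ hρ
      have := intervalIntegral.norm_integral_le_of_norm_le (f := G) hρ.1.le
        (Filter.Eventually.of_forall (hbd ρ hρ)) (hi ρ)
      refine (this : |_| ≤ _).trans ?_
      rw [intervalIntegral.integral_const_mul, integral_rpow (Or.inl (by linarith))]
      simp only [sub_add_cancel]
      rw [Real.zero_rpow ht, abs_of_pos h, sub_zero]
      apply le_of_eq; ring

/-- constants for the first-order problem -/
noncomputable def cst (s p : ℝ) (C : ℕ → ℝ) : ℕ → ℝ
  | 0 => C 0 / |p - s|
  | k + 1 => |s| * cst s p C k + C k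

lemma solve1 (s p : ℝ) (hsp : s ≠ p) (C : ℕ → ℝ) (b : ℝ → ℝ)
    (hb : ContDiffOn ℝ (⊤ : ℕ∞) b (Ioc 0 1))
    (hB : ∀ j : ℕ, ∀ ρ ∈ Ioc (0:ℝ) 1, |rd^[j] b ρ| ≤ C j * ρ ^ p) :
    ∃ u : ℝ → ℝ, ContDiffOn ℝ (⊤ : ℕ∞) u (Ioc 0 1) ∧
      EqOn (rd u) (fun x => s * u x + b x) (Ioc 0 1) ∧
      ∀ j : ℕ, ∀ ρ ∈ Ioc (0:ℝ) 1, |rd^[j] u ρ| ≤ cst s p C j * ρ ^ p := by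
  have hpow : ∀ e : ℝ, ContDiffOn ℝ (⊤ : ℕ∞) (fun x : ℝ => x ^ e) (Ioc 0 1) := fun e =>
    contDiffOn_id.rpow_const_of_ne (fun x hx => hx.1.ne')
  have hgs : ContDiffOn ℝ (⊤ : ℕ∞) (fun x => x ^ (-s-1) * b x) (Ioc 0 1) := (hpow _).mul hb
  obtain ⟨F, hF, hFb⟩ := antideriv (p - s) (C 0) (sub_ne_zero.2 hsp.symm)
    (fun x => x ^ (-s-1) * b x) hgs.continuousOn (by
      intro x hx
      have := hB 0 x hx
      simp only [Function.iterate_zero, id] at this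
      rw [abs_mul, abs_of_pos (Real.rpow_pos_of_pos hx.1 _)]
      have e : x ^ (p - s - 1) = x ^ (-s-1) * x ^ p := by
        rw [← Real.rpow_add hx.1]; congr 1; ring
      rw [e]
      have := mul_le_mul_of_nonneg_left this (Real.rpow_pos_of_pos hx.1 (-s-1)).le
      linarith)
  have hFs : ContDiffOn ℝ (⊤ : ℕ∞) F (Ioc 0 1) := by
    refine (contDiffOn_infty_iff_derivWithin uD).2 ⟨fun x hx => (hF x hx).differentiableWithinAt, ?_⟩
    exact hgs.congr (fun x hx => (hF x hx).derivWithin (uD x hx))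
  have hu : ContDiffOn ℝ (⊤ : ℕ∞) (fun x => x ^ s * F x) (Ioc 0 1) := (hpow s).mul hFs
  have hode : EqOn (rd (fun x => x ^ s * F x)) (fun x => s * (x ^ s * F x) + b x) (Ioc 0 1) := by
    intro x hx
    have hx0 := hx.1
    refine (rd_of_hd hx ((Real.hasDerivAt_rpow_const (p := s) (Or.inl hx.1.ne')).hasDerivWithinAt.mul (hF x hx))).trans ?_
    have e1 : x ^ s = x * x ^ (s-1) := by
      rw [Real.rpow_sub_one hx0.ne', mul_div_cancel₀ _ hx0.ne']
    have e2 : x * (x ^ s * x ^ (-s-1)) = 1 := by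
      rw [← Real.rpow_add hx0]
      have : s + (-s-1) = -1 := by ring
      rw [this, Real.rpow_neg_one, mul_inv_cancel₀ hx0.ne']
    simp only
    linear_combination (-s * F x) * e1 + b x * e2
  refine ⟨_, hu, hode, ?_⟩
  intro j
  induction j with
  | zero =>
    intro x hx
    have := hFb x hx
    simp only [Function.iterate_zero, id, cst]
    rw [abs_mul, abs_of_pos (Real.rpow_pos_of_pos hx.1 _)]
    have e : x ^ p = x ^ s * x ^ (p - s) := by
      rw [← Real.rpow_add hx.1]; congr 1; ring
    rw [e]
    have := mul_le_mul_of_nonneg_left this (Real.rpow_pos_of_pos hx.1 s).le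
    linarith
  | succ j ih =>
    intro x hx
    simp only [Function.iterate_succ, Function.comp, cst]
    rw [rd_iter_congr j hode hx, rd_iter_lin j s hu hb hx]
    have h1 := mul_le_mul_of_nonneg_left (ih x hx) (abs_nonneg s)
    have h2 := hB j x hx
    refine (abs_add_le _ _).trans ?_
    rw [abs_mul]
    linarith

/-- in the non-resonant case `-c + 2 + q ≠ 0`, the ODE `L_l A_* = a_*` has
a smooth solution gaining two orders of decay, with constants depending only on the data
`β, l, q, C₁` (not on `a_*`). -/
theorem stmt5 (β : ℝ) (hβ : -1 < β) (l : ℕ) (q : ℝ) (hq : 0 ≤ q) (C₁ : ℕ → ℝ)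
    (hres : -((l : ℝ) / (β + 1)) + 2 + q ≠ 0) :
    ∃ C₂ : ℕ → ℝ, ∀ a : ℝ → ℝ,
      ContDiffOn ℝ (⊤ : ℕ∞) a (Set.Ioc 0 1) →
      (∀ k₁ : ℕ, ∀ ρ ∈ Set.Ioc (0:ℝ) 1, |rd^[k₁] a ρ| ≤ C₁ k₁ * ρ ^ q) →
      ∃ A : ℝ → ℝ,
        ContDiffOn ℝ (⊤ : ℕ∞) A (Set.Ioc 0 1) ∧
        (∀ ρ ∈ Set.Ioc (0:ℝ) 1, Lop ((l : ℝ) / (β + 1)) A ρ = a ρ) ∧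
        (∀ k₁ : ℕ, ∀ ρ ∈ Set.Ioc (0:ℝ) 1, |rd^[k₁] A ρ| ≤ C₂ k₁ * ρ ^ (q + 2)) := by
  choose K hK using fun k => sq_bound q k C₁
  set c : ℝ := (l : ℝ) / (β + 1) with hc
  have hc0 : 0 ≤ c := div_nonneg (Nat.cast_nonneg l) (by linarith)
  refine ⟨cst (-c) (q + 2) (cst c (q + 2) K), fun a ha hab => ?_⟩
  obtain ⟨u, hu, hue, hub⟩ := solve1 c (q + 2) (by intro h; apply hres; linarith) K
    (fun x => x ^ 2 * a x) ((contDiffOn_id.pow 2).mul ha) (fun j => hK j a ha hab)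
  obtain ⟨A, hA, hAe, hAb⟩ := solve1 (-c) (q + 2) (by intro h; linarith) _ u hu hub
  refine ⟨A, hA, ?_, hAb⟩
  intro x hx
  have hx0 := hx.1.ne'
  have hA1 : EqOn (fun r => derivWithin A (Ioc 0 1) r) (fun r => r⁻¹ * (-c * A r + u r)) (Ioc 0 1) := by
    intro r hr
    simp only
    rw [(smooth_hd hA hr).derivWithin (uD r hr), hAe hr]
  have hA2 := ((hasDerivAt_inv hx0).hasDerivWithinAt (s := Ioc 0 1)).mul
    (((smooth_hd hA hx).const_mul (-c)).add (smooth_hd hu hx))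
  unfold Lop
  rw [derivWithin_congr hA1 (hA1 hx)]
  have e := hA1 hx
  simp only at e
  rw [e]
  have e2 := hA2.derivWithin (uD x hx)
  rw [show derivWithin (fun r => r⁻¹ * (-c * A r + u r)) (Ioc 0 1) x = _ from e2, hAe hx, hue hx]
  simp
  field_simp
  ring
end

section
/- Let β > −1 and q ≥ 0, and let f_o be a smooth function on {0 < ρ ≤ 1} (2π-periodic in θ) satisfying, for all nonnegative integers k₁, k₂, a bound |(ρ∂_ρ)^{k₁}∂_θ^{k₂}f_o| ≤ C(k₁,k₂)ρ^q on {0 < ρ ≤ 1}. Then there exists a smooth function w_o on {0 < ρ ≤ 1} with △̃w_o = f_o, such that: if q ≠ k/(β+1) − 2 for every nonnegative integer k, then w_o satisfies |(ρ∂_ρ)^{k₁}∂_θ^{k₂}w_o| ≤ C'(k₁,k₂)ρ^{q+2} for all k₁, k₂ and suitable constants C'(k₁,k₂); otherwise, for every q' < 2 + q there exists such a w_o with |(ρ∂_ρ)^{k₁}∂_θ^{k₂}w_o| ≤ C'(k₁,k₂)ρ^{q'}. -/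
open Real Set

/-- `∂/∂ρ` on functions `u(ρ,θ)` defined for `ρ ∈ (0,1]` (derivative within `(0,1]`). -/
noncomputable def dR (u : ℝ → ℝ → ℝ) : ℝ → ℝ → ℝ :=
  fun ρ θ => derivWithin (fun r => u r θ) (Set.Ioc 0 1) ρ

/-- `∂/∂θ` on functions `u(ρ,θ)`. -/
noncomputable def dT (u : ℝ → ℝ → ℝ) : ℝ → ℝ → ℝ :=
  fun ρ θ => deriv (fun s => u ρ s) θ

/-- `ρ ∂/∂ρ` on functions defined for `ρ ∈ (0,1]`. -/
noncomputable def pdRhoW (u : ℝ → ℝ → ℝ) : ℝ → ℝ → ℝ :=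
  fun ρ θ => ρ * dR u ρ θ

/-- The cone Laplacian `△̃ = ∂²/∂ρ² + ρ⁻¹ ∂/∂ρ + (β+1)⁻² ρ⁻² ∂²/∂θ²`
(ρ-derivatives within `(0,1]`). -/
noncomputable def coneLapW (β : ℝ) (u : ℝ → ℝ → ℝ) (ρ θ : ℝ) : ℝ :=
  dR (dR u) ρ θ + ρ⁻¹ * dR u ρ θ + ((β + 1) ^ 2)⁻¹ * (ρ ^ 2)⁻¹ * dT (dT u) ρ θ

/-- A solution `w` of `△̃w = f` on `{0 < ρ ≤ 1}` which is smooth, `2π`-periodic in `θ`,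
and has the derivative bounds `|(ρ∂_ρ)^{k₁} ∂_θ^{k₂} w| ≤ C'(k₁,k₂) ρ^r`. -/
def GoodSol (β : ℝ) (f w : ℝ → ℝ → ℝ) (r : ℝ) : Prop :=
  ContDiffOn ℝ (⊤ : ℕ∞) (fun p : ℝ × ℝ => w p.1 p.2) {p : ℝ × ℝ | 0 < p.1 ∧ p.1 ≤ 1} ∧
  (∀ ρ θ : ℝ, w ρ (θ + 2 * π) = w ρ θ) ∧
  (∀ ρ θ : ℝ, 0 < ρ → ρ ≤ 1 → coneLapW β w ρ θ = f ρ θ) ∧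
  (∀ k₁ k₂ : ℕ, ∃ C' : ℝ, ∀ ρ θ : ℝ, 0 < ρ → ρ ≤ 1 →
    |pdRhoW^[k₁] (dT^[k₂] w) ρ θ| ≤ C' * ρ ^ r)

open Filter Topology MeasureTheory

/-- `C¹` extension across `ρ = 1`. -/
lemma ext_hasDeriv {E : Type*} [NormedAddCommGroup E] [NormedSpace ℝ E] {u u' : ℝ → E}
    (h : ∀ ρ ∈ Ioc (0:ℝ) 1, HasDerivWithinAt u (u' ρ) (Ioc 0 1) ρ) {ρ : ℝ} (hρ : 0 < ρ) :
    HasDerivAt (fun x => u (min x 1) + (x - min x 1) • u' 1) (u' (min ρ 1)) ρ := by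
  rcases lt_trichotomy ρ 1 with h1 | h1 | h1
  · rw [min_eq_left h1.le]
    have := (h ρ ⟨hρ, h1.le⟩).hasDerivAt (Ioc_mem_nhds hρ h1)
    refine this.congr_of_eventuallyEq ?_
    filter_upwards [Iio_mem_nhds h1] with x hx
    simp [min_eq_left (le_of_lt (show x < 1 from hx))]
  · subst h1
    rw [min_self, ← hasDerivWithinAt_univ, ← Iic_union_Ici (a := (1:ℝ))]
    apply HasDerivWithinAt.union
    · have := (h 1 ⟨hρ, le_rfl⟩).mono_of_mem_nhdsWithin (Ioc_mem_nhdsLE hρ)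
      refine this.congr (fun x hx => ?_) ?_
      · simp [min_eq_left (show x ≤ 1 from hx)]
      · simp
    · have : HasDerivWithinAt (fun x : ℝ => u 1 + (x - 1) • u' 1) (u' 1) (Ici 1) 1 := by
        simpa using ((((hasDerivWithinAt_id (1:ℝ) (Ici 1)).sub_const 1).smul_const (u' 1)).const_add (u 1))
      refine this.congr (fun x hx => ?_) ?_
      · simp [min_eq_right (show 1 ≤ x from hx)]
      · simp
  · rw [min_eq_right h1.le]
    have : HasDerivAt (fun x : ℝ => u 1 + (x - 1) • u' 1) (u' 1) ρ := by
        simpa using ((((hasDerivAt_id ρ).sub_const 1).smul_const (u' 1)).const_add (u 1))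
    refine this.congr_of_eventuallyEq ?_
    filter_upwards [Ioi_mem_nhds h1] with x hx
    simp [min_eq_right (le_of_lt (show 1 < x from hx))]

lemma solve1_s6 (g : ℝ → ℂ) (hg : ContinuousOn g (Ioc 0 1)) (r a δ : ℝ) (hδ : 0 < δ)
    (hra : δ ≤ |r - a|) (hM0 : ∃ M, ∀ ρ ∈ Ioc (0:ℝ) 1, ‖g ρ‖ ≤ M * ρ ^ r) :
    ∃ v : ℝ → ℂ, (∀ ρ ∈ Ioc (0:ℝ) 1,
        HasDerivWithinAt v (ρ⁻¹ • (a • v ρ + g ρ)) (Ioc 0 1) ρ) ∧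
      ∀ M, (∀ ρ ∈ Ioc (0:ℝ) 1, ‖g ρ‖ ≤ M * ρ ^ r) →
        ∀ ρ ∈ Ioc (0:ℝ) 1, ‖v ρ‖ ≤ M / δ * ρ ^ r := by
  set h : ℝ → ℂ := fun s => s ^ (-a - 1) • g (min s 1) with hh
  have hcont : ContinuousOn h (Ioi 0) := by
    refine ContinuousOn.smul (f := fun s : ℝ => s ^ (-a - 1)) (g := fun s : ℝ => g (min s 1)) ?_ ?_
    · intro x hx
      exact (Real.continuousAt_rpow_const x _ (Or.inl (ne_of_gt hx))).continuousWithinAt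
    · apply hg.comp (by fun_prop)
      intro x hx
      exact ⟨lt_min hx one_pos, min_le_right _ _⟩
  have hFTC : ∀ b ρ : ℝ, 0 < ρ → IntervalIntegrable h volume b ρ →
      HasDerivAt (fun x => ∫ s in b..x, h s) (h ρ) ρ := by
    intro b ρ hρ hi
    exact intervalIntegral.integral_hasDerivAt_right hi
      (hcont.stronglyMeasurableAtFilter isOpen_Ioi ρ hρ) (hcont.continuousAt (Ioi_mem_nhds hρ))
  have key : ∀ b, (∀ ρ ∈ Ioc (0:ℝ) 1, IntervalIntegrable h volume b ρ) → ∀ ρ ∈ Ioc (0:ℝ) 1,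
      HasDerivWithinAt (fun x : ℝ => x ^ a • ∫ s in b..x, h s)
        (ρ⁻¹ • (a • (ρ ^ a • ∫ s in b..ρ, h s) + g ρ)) (Ioc 0 1) ρ := by
    intro b hb ρ hρ
    have h0 : (0:ℝ) < ρ := hρ.1
    have := ((Real.hasDerivAt_rpow_const (p := a) (Or.inl h0.ne')).smul
      (hFTC b ρ h0 (hb ρ hρ))).hasDerivWithinAt (s := Ioc 0 1)
    refine HasDerivWithinAt.congr_deriv this (Eq.symm ?_)
    rw [hh]
    simp only [min_eq_left hρ.2]
    rw [smul_smul (ρ ^ a) (ρ ^ (-a - 1)), ← Real.rpow_add h0, Real.rpow_sub_one h0.ne']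
    rw [show a + (-a - 1) = (-1:ℝ) by ring, Real.rpow_neg_one, smul_add, smul_smul, smul_smul, add_comm]
    congr 2
    field_simp
  have hbd : ∀ M, (∀ ρ ∈ Ioc (0:ℝ) 1, ‖g ρ‖ ≤ M * ρ ^ r) → ∀ ρ ∈ Ioc (0:ℝ) 1,
      ‖h ρ‖ ≤ M * ρ ^ (r - a - 1) := by
    intro M hM ρ hρ
    have h0 : (0:ℝ) < ρ := hρ.1
    rw [hh]
    simp only [min_eq_left hρ.2]
    rw [norm_smul, Real.norm_of_nonneg (Real.rpow_nonneg h0.le _)]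
    calc ρ ^ (-a - 1) * ‖g ρ‖ ≤ ρ ^ (-a - 1) * (M * ρ ^ r) := by
          gcongr
          exact hM ρ hρ
      _ = M * (ρ ^ (-a-1) * ρ ^ r) := by ring
      _ = _ := by rw [← Real.rpow_add h0]; ring_nf
  have hMnn : ∀ M, (∀ ρ ∈ Ioc (0:ℝ) 1, ‖g ρ‖ ≤ M * ρ ^ r) → 0 ≤ M := by
    intro M hM
    have := hM 1 ⟨one_pos, le_rfl⟩
    rw [Real.one_rpow, mul_one] at this
    exact (norm_nonneg _).trans this
  have fin : ∀ M ρ I : ℝ, 0 ≤ M → 0 < ρ → I ≤ M * (ρ ^ (r - a) / |r - a|) →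
      ρ ^ a * I ≤ M / δ * ρ ^ r := by
    intro M ρ I hM hρ hI
    calc ρ ^ a * I ≤ ρ ^ a * (M * (ρ ^ (r - a) / δ)) := by
          gcongr
          refine hI.trans ?_
          gcongr
      _ = M / δ * (ρ ^ a * ρ ^ (r - a)) := by ring
      _ = _ := by rw [← Real.rpow_add hρ]; ring_nf
  rcases lt_or_ge a r with har | har
  · have hint1 : IntervalIntegrable h volume 0 1 := by
      obtain ⟨M, hM⟩ := hM0
      have hi : IntervalIntegrable (fun s : ℝ => M * s ^ (r - a - 1)) volume 0 1 :=
        (intervalIntegral.intervalIntegrable_rpow' (by linarith)).const_mul M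
      refine hi.mono_fun' ?_ ?_
      · rw [uIoc_of_le zero_le_one]
        exact (hcont.mono (fun x hx => hx.1)).aestronglyMeasurable measurableSet_Ioc
      · rw [uIoc_of_le zero_le_one]
        filter_upwards [ae_restrict_mem measurableSet_Ioc] with s hs
        exact hbd M hM s hs
    have hint : ∀ ρ ∈ Ioc (0:ℝ) 1, IntervalIntegrable h volume 0 ρ := by
      intro ρ hρ
      refine hint1.mono_set ?_
      rw [uIcc_of_le hρ.1.le, uIcc_of_le zero_le_one]
      exact Icc_subset_Icc_right hρ.2
    refine ⟨_, key 0 hint, fun M hM ρ hρ => ?_⟩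
    rw [norm_smul, Real.norm_of_nonneg (Real.rpow_nonneg hρ.1.le _)]
    apply fin M ρ _ (hMnn M hM) hρ.1
    have hi : IntervalIntegrable (fun s : ℝ => M * s ^ (r - a - 1)) volume 0 ρ :=
        (intervalIntegral.intervalIntegrable_rpow' (by linarith)).const_mul M
    refine (intervalIntegral.norm_integral_le_of_norm_le hρ.1.le ?_ hi).trans (le_of_eq ?_)
    · exact ae_of_all _ fun s hs => hbd M hM s ⟨hs.1, hs.2.trans hρ.2⟩
    · rw [intervalIntegral.integral_const_mul, integral_rpow (Or.inl (by linarith)),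
        abs_of_pos (by linarith), sub_add_cancel, Real.zero_rpow (by linarith), sub_zero]
  · have hne : a ≠ r := by
      rintro rfl
      simp at hra
      linarith
    have har : r < a := lt_of_le_of_ne har hne.symm
    have hsub : ∀ ρ ∈ Ioc (0:ℝ) 1, uIcc ρ 1 ⊆ Ioi 0 := by
      intro ρ hρ x hx
      rw [uIcc_of_le hρ.2] at hx
      exact hρ.1.trans_le hx.1
    have hint : ∀ ρ ∈ Ioc (0:ℝ) 1, IntervalIntegrable h volume ρ 1 := fun ρ hρ =>
      (hcont.mono (hsub ρ hρ)).intervalIntegrable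
    refine ⟨_, key 1 (fun ρ hρ => (hint ρ hρ).symm), fun M hM ρ hρ => ?_⟩
    rw [norm_smul, Real.norm_of_nonneg (Real.rpow_nonneg hρ.1.le _)]
    apply fin M ρ _ (hMnn M hM) hρ.1
    rw [intervalIntegral.integral_symm, norm_neg]
    have h0 : (0:ℝ) ∉ uIcc ρ 1 := fun h => lt_irrefl (0:ℝ) (mem_Ioi.1 (hsub ρ hρ h))
    have hi : IntervalIntegrable (fun s : ℝ => M * s ^ (r - a - 1)) volume ρ 1 :=
        (intervalIntegral.intervalIntegrable_rpow (Or.inr h0)).const_mul M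
    refine (intervalIntegral.norm_integral_le_of_norm_le hρ.2 ?_ hi).trans ?_
    · exact ae_of_all _ fun s hs => hbd M hM s ⟨hρ.1.trans hs.1, hs.2⟩
    · rw [intervalIntegral.integral_const_mul, integral_rpow (Or.inr ⟨by linarith, h0⟩),
        sub_add_cancel, abs_of_neg (by linarith), Real.one_rpow]
      apply mul_le_mul_of_nonneg_left _ (hMnn M hM)
      rw [show (1 - ρ ^ (r - a)) / (r - a) = (ρ ^ (r - a) - 1) / -(r - a) by
        rw [div_neg, ← neg_div]; ring_nf]
      apply div_le_div_of_nonneg_right (by linarith) (by linarith)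

/-- A family of coefficients `c k j`, where `c k (j+1) = ρ∂_ρ (c k j)`, rapidly decaying in `k`. -/
structure Rapid (r : ℝ) (c : ℤ → ℕ → ℝ → ℂ) : Prop where
  der : ∀ k j, ∀ ρ ∈ Ioc (0:ℝ) 1, HasDerivWithinAt (c k j) (ρ⁻¹ • c k (j+1) ρ) (Ioc 0 1) ρ
  bd : ∀ j m : ℕ, ∃ A : ℝ, ∀ k : ℤ, ∀ ρ ∈ Ioc (0:ℝ) 1,
    (1 + |(k:ℝ)|) ^ m * ‖c k j ρ‖ ≤ A * ρ ^ r

lemma Rapid.solve {r : ℝ} {c : ℤ → ℕ → ℝ → ℂ} (hc : Rapid r c) (a : ℤ → ℝ) (α δ : ℝ) (hδ : 0 < δ)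
    (hα : ∀ k, |a k| ≤ α * (1 + |(k:ℝ)|)) (hra : ∀ k, δ ≤ |r - a k|) :
    ∃ v : ℤ → ℕ → ℝ → ℂ, Rapid r v ∧ ∀ k j ρ, v k (j+1) ρ = a k • v k j ρ + c k j ρ := by
  have ex := fun k => solve1_s6 (c k 0) (fun ρ hρ => (hc.der k 0 ρ hρ).continuousWithinAt) r (a k) δ hδ
    (hra k) (by
      obtain ⟨A, hA⟩ := hc.bd 0 0
      exact ⟨A, fun ρ hρ => by simpa using hA k ρ hρ⟩)
  choose v0 hv0 hv0' using ex
  let v : ℤ → ℕ → ℝ → ℂ := fun k j =>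
    Nat.rec (v0 k) (fun i p => fun ρ => a k • p ρ + c k i ρ) j
  have hvs : ∀ k j ρ, v k (j+1) ρ = a k • v k j ρ + c k j ρ := fun _ _ _ => rfl
  refine ⟨v, ⟨?_, ?_⟩, hvs⟩
  · intro k j
    induction j with
    | zero => exact hv0 k
    | succ j ih =>
      intro ρ hρ
      have := ((ih ρ hρ).const_smul (a k)).add (hc.der k j ρ hρ)
      rw [hvs k (j+1), smul_add, smul_comm]
      exact this
  · intro j
    induction j with
    | zero =>
      intro m
      obtain ⟨A, hA⟩ := hc.bd 0 m
      refine ⟨A / δ, fun k ρ hρ => ?_⟩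
      have hp : 0 < (1 + |(k:ℝ)|) ^ m := by positivity
      have := hv0' k (A / (1 + |(k:ℝ)|) ^ m) (fun ρ hρ => by
        rw [div_mul_eq_mul_div, le_div_iff₀ hp, mul_comm]
        exact hA k ρ hρ) ρ hρ
      calc (1 + |(k:ℝ)|) ^ m * ‖v0 k ρ‖
          ≤ (1 + |(k:ℝ)|) ^ m * (A / (1 + |(k:ℝ)|) ^ m / δ * ρ ^ r) := by gcongr
        _ = _ := by field_simp
    | succ j ih =>
      intro m
      obtain ⟨A, hA⟩ := hc.bd j m
      obtain ⟨B, hB⟩ := ih (m+1)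
      refine ⟨|α| * B + A, fun k ρ hρ => ?_⟩
      rw [hvs]
      have hp : 0 < 1 + |(k:ℝ)| := by positivity
      have h1 : |a k| ≤ |α| * (1 + |(k:ℝ)|) := (hα k).trans (by gcongr; exact le_abs_self α)
      calc (1 + |(k:ℝ)|) ^ m * ‖a k • v k j ρ + c k j ρ‖
          ≤ (1 + |(k:ℝ)|) ^ m * (|α| * (1 + |(k:ℝ)|) * ‖v k j ρ‖ + ‖c k j ρ‖) := by
            gcongr
            refine (norm_add_le _ _).trans ?_
            rw [norm_smul, Real.norm_eq_abs]
            gcongr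
        _ = |α| * ((1 + |(k:ℝ)|) ^ (m+1) * ‖v k j ρ‖) + (1 + |(k:ℝ)|) ^ m * ‖c k j ρ‖ := by ring
        _ ≤ |α| * (B * ρ ^ r) + A * ρ ^ r := by
            exact add_le_add (mul_le_mul_of_nonneg_left (hB k ρ hρ) (abs_nonneg α)) (hA k ρ hρ)
        _ = _ := by ring

lemma Rapid.shift {r : ℝ} {c : ℤ → ℕ → ℝ → ℂ} (hc : Rapid r c) :
    Rapid r (fun k j ρ => 2 * c k j ρ + c k (j+1) ρ) := by
  refine ⟨fun k j ρ hρ => ?_, fun j m => ?_⟩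
  · have := ((hc.der k j ρ hρ).const_mul 2).add (hc.der k (j+1) ρ hρ)
    refine HasDerivWithinAt.congr_deriv this (Eq.symm ?_)
    rw [smul_add, mul_smul_comm]
  · obtain ⟨A, hA⟩ := hc.bd j m
    obtain ⟨B, hB⟩ := hc.bd (j+1) m
    refine ⟨2 * A + B, fun k ρ hρ => ?_⟩
    have hp : 0 < 1 + |(k:ℝ)| := by positivity
    have h2 : ‖2 * c k j ρ + c k (j+1) ρ‖ ≤ 2 * ‖c k j ρ‖ + ‖c k (j+1) ρ‖ :=
      (norm_add_le _ _).trans (by simp)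
    calc _ ≤ (1 + |(k:ℝ)|) ^ m * (2 * ‖c k j ρ‖ + ‖c k (j+1) ρ‖) := by gcongr
      _ = 2 * ((1 + |(k:ℝ)|) ^ m * ‖c k j ρ‖) + (1 + |(k:ℝ)|) ^ m * ‖c k (j+1) ρ‖ := by ring
      _ ≤ 2 * (A * ρ ^ r) + B * ρ ^ r := by
        exact add_le_add (mul_le_mul_of_nonneg_left (hA k ρ hρ) zero_le_two) (hB k ρ hρ)
      _ = _ := by ring

lemma Rapid.mulSq {q : ℝ} {c : ℤ → ℕ → ℝ → ℂ} (hc : Rapid q c) :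
    ∃ c' : ℤ → ℕ → ℝ → ℂ, Rapid (q + 2) c' ∧ ∀ k ρ, c' k 0 ρ = (ρ ^ 2 : ℝ) • c k 0 ρ := by
  let E : (ℤ → ℕ → ℝ → ℂ) → (ℤ → ℕ → ℝ → ℂ) := fun c k j ρ => 2 * c k j ρ + c k (j+1) ρ
  have hE : ∀ j, Rapid q (E^[j] c) := by
    intro j
    induction j with
    | zero => exact hc
    | succ j ih => rw [Function.iterate_succ_apply']; exact ih.shift
  refine ⟨fun k j ρ => (ρ ^ 2 : ℝ) • (E^[j] c) k 0 ρ, ⟨fun k j ρ hρ => ?_, fun j m => ?_⟩, ?_⟩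
  · have h0 : ρ ≠ 0 := hρ.1.ne'
    have := ((hasDerivAt_pow 2 ρ).hasDerivWithinAt (s := Ioc 0 1)).smul ((hE j).der k 0 ρ hρ)
    refine HasDerivWithinAt.congr_deriv this (Eq.symm ?_)
    rw [Function.iterate_succ_apply']
    simp only [E, Complex.real_smul]
    push_cast
    have : (ρ:ℂ) ≠ 0 := by exact_mod_cast h0
    field_simp
    ring
  · obtain ⟨A, hA⟩ := (hE j).bd 0 m
    refine ⟨A, fun k ρ hρ => ?_⟩
    rw [norm_smul, Real.norm_of_nonneg (by positivity), Real.rpow_add hρ.1]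
    have := mul_le_mul_of_nonneg_left (hA k ρ hρ) (sq_nonneg ρ)
    rw [Real.rpow_two]
    linarith
  · intro k ρ
    rfl

lemma S_eq : {p : ℝ × ℝ | 0 < p.1 ∧ p.1 ≤ 1} = Ioc (0:ℝ) 1 ×ˢ (univ : Set ℝ) := by
  ext p; simp

lemma S_uniq : UniqueDiffOn ℝ {p : ℝ × ℝ | 0 < p.1 ∧ p.1 ≤ 1} := by
  rw [S_eq]; exact (uniqueDiffOn_Ioc 0 1).prod uniqueDiffOn_univ

/-- Total differentiability from continuous partial derivatives on the half-closed strip. -/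
lemma total_of_partial (u a b : ℝ → ℝ → ℝ)
    (ha : ContinuousOn (fun p : ℝ × ℝ => a p.1 p.2) {p : ℝ × ℝ | 0 < p.1 ∧ p.1 ≤ 1})
    (hu : ∀ ρ ∈ Ioc (0:ℝ) 1, ∀ θ, HasDerivWithinAt (fun x => u x θ) (a ρ θ) (Ioc 0 1) ρ)
    (hv : ∀ ρ ∈ Ioc (0:ℝ) 1, ∀ θ, HasDerivAt (fun x => u ρ x) (b ρ θ) θ)
    (p : ℝ × ℝ) (hp : p ∈ {p : ℝ × ℝ | 0 < p.1 ∧ p.1 ≤ 1}) :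
    HasFDerivWithinAt (fun p : ℝ × ℝ => u p.1 p.2)
      (a p.1 p.2 • ContinuousLinearMap.fst ℝ ℝ ℝ + b p.1 p.2 • ContinuousLinearMap.snd ℝ ℝ ℝ)
      {p : ℝ × ℝ | 0 < p.1 ∧ p.1 ≤ 1} p := by
  obtain ⟨ρ, θ⟩ := p
  have hρ : ρ ∈ Ioc (0:ℝ) 1 := hp
  have h2 : HasFDerivWithinAt (fun p : ℝ × ℝ => u ρ p.2)
      (b ρ θ • ContinuousLinearMap.snd ℝ ℝ ℝ) {p : ℝ × ℝ | 0 < p.1 ∧ p.1 ≤ 1} (ρ, θ) :=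
    ((hv ρ hρ θ).comp_hasFDerivAt (ρ, θ) (f := Prod.snd) (hasFDerivAt_snd)).hasFDerivWithinAt
  have h1 : HasFDerivWithinAt (fun p : ℝ × ℝ => u p.1 p.2 - u ρ p.2)
      (a ρ θ • ContinuousLinearMap.fst ℝ ℝ ℝ) {p : ℝ × ℝ | 0 < p.1 ∧ p.1 ≤ 1} (ρ, θ) := by
    rw [hasFDerivWithinAt_iff_isLittleO, Asymptotics.isLittleO_iff]
    intro ε hε
    have hc := Metric.continuousWithinAt_iff.1 (ha (ρ, θ) hp) ε hε
    obtain ⟨d, hd, hc⟩ := hc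
    filter_upwards [self_mem_nhdsWithin, mem_nhdsWithin_of_mem_nhds (Metric.ball_mem_nhds (ρ, θ) hd)]
      with p hpS hpb
    obtain ⟨x, y⟩ := p
    have hx : x ∈ Ioc (0:ℝ) 1 := hpS
    rw [Metric.mem_ball, Prod.dist_eq, max_lt_iff] at hpb
    have hconv : Convex ℝ (Ioc (0:ℝ) 1 ∩ Metric.ball ρ d) :=
      (convex_Ioc 0 1).inter (convex_ball ρ d)
    have mv := hconv.norm_image_sub_le_of_norm_hasDerivWithin_le
      (f := fun z => u z y - a ρ θ * z) (f' := fun z => a z y - a ρ θ) (C := ε) (x := ρ) (y := x)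
      (fun z hz => (((hu z hz.1 y).mono inter_subset_left).sub
        (by simpa using (hasDerivWithinAt_id z _).const_mul (a ρ θ))))
      (fun z hz => by
        have := @hc (z, y) hz.1 (by
          rw [Prod.dist_eq, max_lt_iff]; exact ⟨hz.2, hpb.2⟩)
        rw [dist_eq_norm] at this
        exact this.le)
      ⟨hρ, Metric.mem_ball_self hd⟩ ⟨hx, hpb.1⟩
    have e : u x y - u ρ y - (u ρ θ - u ρ θ) -
      (a ρ θ • ContinuousLinearMap.fst ℝ ℝ ℝ) ((x, y) - (ρ, θ)) =
      u x y - a ρ θ * x - (u ρ y - a ρ θ * ρ) := by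
      simp; ring
    show ‖u x y - u ρ y - (u ρ θ - u ρ θ) -
      (a ρ θ • ContinuousLinearMap.fst ℝ ℝ ℝ) ((x, y) - (ρ, θ))‖ ≤ ε * ‖(x, y) - (ρ, θ)‖
    rw [e]
    refine mv.trans ?_
    gcongr
    exact norm_fst_le ((x, y) - (ρ, θ))
  have := h1.add h2
  refine this.congr_of_eventuallyEq (Eventually.of_forall fun p => ?_) ?_ <;> simp

/-- A family `U j m = (ρ∂_ρ)^j ∂_θ^m U 0 0`. -/
structure Fam (U : ℕ → ℕ → ℝ → ℝ → ℝ) : Prop where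
  cont : ∀ j m, ContinuousOn (fun p : ℝ × ℝ => U j m p.1 p.2) {p : ℝ × ℝ | 0 < p.1 ∧ p.1 ≤ 1}
  dr : ∀ j m, ∀ ρ ∈ Ioc (0:ℝ) 1, ∀ θ,
    HasDerivWithinAt (fun x => U j m x θ) (ρ⁻¹ * U (j+1) m ρ θ) (Ioc 0 1) ρ
  dt : ∀ j m, ∀ ρ ∈ Ioc (0:ℝ) 1, ∀ θ, HasDerivAt (fun x => U j m ρ x) (U j (m+1) ρ θ) θ

lemma inv_contDiffOn (n : WithTop ℕ∞) :
    ContDiffOn ℝ n (fun p : ℝ × ℝ => p.1⁻¹) {p : ℝ × ℝ | 0 < p.1 ∧ p.1 ≤ 1} :=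
  contDiff_fst.contDiffOn.inv (fun p hp => ne_of_gt hp.1)

lemma Fam.contDiffOn {U : ℕ → ℕ → ℝ → ℝ → ℝ} (hU : Fam U) (n : ℕ) : ∀ j m,
    ContDiffOn ℝ n (fun p : ℝ × ℝ => U j m p.1 p.2) {p : ℝ × ℝ | 0 < p.1 ∧ p.1 ≤ 1} := by
  induction n with
  | zero => intro j m; exact contDiffOn_zero.2 (hU.cont j m)
  | succ n ih =>
    intro j m
    have := total_of_partial (U j m) (fun ρ θ => ρ⁻¹ * U (j+1) m ρ θ) (U j (m+1))
      ((inv_contDiffOn 0).continuousOn.mul (hU.cont (j+1) m)) (hU.dr j m) (hU.dt j m)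
    rw [Nat.cast_add, Nat.cast_one, contDiffOn_succ_iff_hasFDerivWithinAt_of_uniqueDiffOn S_uniq]
    refine ⟨by simp, _, ?_, this⟩
    exact (((inv_contDiffOn n).mul (ih (j+1) m)).smul contDiffOn_const).add
      ((ih j (m+1)).smul contDiffOn_const)

lemma dR_eq {u : ℝ → ℝ → ℝ} {ρ θ d : ℝ} (hρ : ρ ∈ Ioc (0:ℝ) 1)
    (h : HasDerivWithinAt (fun x => u x θ) d (Ioc 0 1) ρ) : dR u ρ θ = d :=
  h.derivWithin (uniqueDiffOn_Ioc 0 1 ρ hρ)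

lemma dR_congr {u v : ℝ → ℝ → ℝ} (h : ∀ ρ ∈ Ioc (0:ℝ) 1, ∀ θ, u ρ θ = v ρ θ)
    {ρ θ : ℝ} (hρ : ρ ∈ Ioc (0:ℝ) 1) : dR u ρ θ = dR v ρ θ :=
  derivWithin_congr (fun x hx => h x hx θ) (h ρ hρ θ)

lemma Fam.iter {U : ℕ → ℕ → ℝ → ℝ → ℝ} (hU : Fam U) (j m : ℕ) :
    ∀ ρ ∈ Ioc (0:ℝ) 1, ∀ θ, pdRhoW^[j] (dT^[m] (U 0 0)) ρ θ = U j m ρ θ := by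
  induction j with
  | zero =>
    induction m with
    | zero => intro ρ hρ θ; rfl
    | succ m ih =>
      intro ρ hρ θ
      simp only [Function.iterate_zero, id] at ih ⊢
      rw [Function.iterate_succ_apply']
      have : (fun s => dT^[m] (U 0 0) ρ s) = fun s => U 0 m ρ s := funext fun s => ih ρ hρ s
      simp only [dT] at this ⊢
      rw [this]
      exact (hU.dt 0 m ρ hρ θ).deriv
  | succ j ih =>
    intro ρ hρ θ
    rw [Function.iterate_succ_apply']
    have h0 : ρ ≠ 0 := hρ.1.ne'
    simp only [pdRhoW] at ih ⊢
    rw [dR_congr ih hρ, dR_eq hρ (hU.dr j m ρ hρ θ), mul_inv_cancel_left₀ h0]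

/-- Slices of a smooth function on the strip. -/
lemma smooth_dR {u : ℝ → ℝ → ℝ}
    (hu : ContDiffOn ℝ (⊤ : ℕ∞) (fun p : ℝ × ℝ => u p.1 p.2) {p : ℝ × ℝ | 0 < p.1 ∧ p.1 ≤ 1}) :
    ContDiffOn ℝ (⊤ : ℕ∞) (fun p : ℝ × ℝ => dR u p.1 p.2) {p : ℝ × ℝ | 0 < p.1 ∧ p.1 ≤ 1} ∧
    ∀ ρ ∈ Ioc (0:ℝ) 1, ∀ θ, HasDerivWithinAt (fun x => u x θ) (dR u ρ θ) (Ioc 0 1) ρ := by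
  have key : ∀ ρ ∈ Ioc (0:ℝ) 1, ∀ θ, HasDerivWithinAt (fun x => u x θ)
      (fderivWithin ℝ (fun p : ℝ × ℝ => u p.1 p.2) {p : ℝ × ℝ | 0 < p.1 ∧ p.1 ≤ 1} (ρ, θ) (1, 0))
      (Ioc 0 1) ρ := by
    intro ρ hρ θ
    have h1 := (hu.differentiableOn (by simp) (ρ, θ) hρ).hasFDerivWithinAt
    have h2 : HasDerivWithinAt (fun x : ℝ => (x, θ)) ((1:ℝ), (0:ℝ)) (Ioc 0 1) ρ :=
      (hasDerivWithinAt_id ρ _).prodMk (hasDerivWithinAt_const ρ _ θ)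
    exact h1.comp_hasDerivWithinAt ρ h2 (fun x hx => hx)
  have e : ∀ ρ ∈ Ioc (0:ℝ) 1, ∀ θ, dR u ρ θ =
      fderivWithin ℝ (fun p : ℝ × ℝ => u p.1 p.2) {p : ℝ × ℝ | 0 < p.1 ∧ p.1 ≤ 1} (ρ, θ) (1, 0) :=
    fun ρ hρ θ => dR_eq hρ (key ρ hρ θ)
  refine ⟨?_, fun ρ hρ θ => e ρ hρ θ ▸ key ρ hρ θ⟩
  refine ContDiffOn.congr ?_ (fun p hp => e p.1 hp p.2)
  exact (hu.fderivWithin S_uniq (by simp)).clm_apply contDiffOn_const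

lemma smooth_dT {u : ℝ → ℝ → ℝ}
    (hu : ContDiffOn ℝ (⊤ : ℕ∞) (fun p : ℝ × ℝ => u p.1 p.2) {p : ℝ × ℝ | 0 < p.1 ∧ p.1 ≤ 1}) :
    ContDiffOn ℝ (⊤ : ℕ∞) (fun p : ℝ × ℝ => dT u p.1 p.2) {p : ℝ × ℝ | 0 < p.1 ∧ p.1 ≤ 1} ∧
    ∀ ρ ∈ Ioc (0:ℝ) 1, ∀ θ, HasDerivAt (fun x => u ρ x) (dT u ρ θ) θ := by
  have key : ∀ ρ ∈ Ioc (0:ℝ) 1, ∀ θ, HasDerivAt (fun x => u ρ x)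
      (fderivWithin ℝ (fun p : ℝ × ℝ => u p.1 p.2) {p : ℝ × ℝ | 0 < p.1 ∧ p.1 ≤ 1} (ρ, θ) (0, 1))
      θ := by
    intro ρ hρ θ
    have h1 := (hu.differentiableOn (by simp) (ρ, θ) hρ).hasFDerivWithinAt
    have h2 : HasDerivWithinAt (fun x : ℝ => (ρ, x)) ((0:ℝ), (1:ℝ)) univ θ :=
      (hasDerivWithinAt_const θ _ ρ).prodMk (hasDerivWithinAt_id θ _)
    rw [← hasDerivWithinAt_univ]
    exact h1.comp_hasDerivWithinAt θ h2 (fun x _ => hρ)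
  have e : ∀ ρ ∈ Ioc (0:ℝ) 1, ∀ θ, dT u ρ θ =
      fderivWithin ℝ (fun p : ℝ × ℝ => u p.1 p.2) {p : ℝ × ℝ | 0 < p.1 ∧ p.1 ≤ 1} (ρ, θ) (0, 1) :=
    fun ρ hρ θ => (key ρ hρ θ).deriv
  refine ⟨?_, fun ρ hρ θ => e ρ hρ θ ▸ key ρ hρ θ⟩
  refine ContDiffOn.congr ?_ (fun p hp => e p.1 hp p.2)
  exact (hu.fderivWithin S_uniq (by simp)).clm_apply contDiffOn_const

lemma smooth_iter {f : ℝ → ℝ → ℝ}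
    (hf : ContDiffOn ℝ (⊤ : ℕ∞) (fun p : ℝ × ℝ => f p.1 p.2) {p : ℝ × ℝ | 0 < p.1 ∧ p.1 ≤ 1})
    (j m : ℕ) : ContDiffOn ℝ (⊤ : ℕ∞) (fun p : ℝ × ℝ => pdRhoW^[j] (dT^[m] f) p.1 p.2)
      {p : ℝ × ℝ | 0 < p.1 ∧ p.1 ≤ 1} := by
  induction j with
  | zero =>
    induction m with
    | zero => exact hf
    | succ m ih =>
      simp only [Function.iterate_zero, id] at ih ⊢
      simp only [Function.iterate_succ_apply']
      exact (smooth_dT ih).1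
  | succ j ih =>
    simp only [Function.iterate_succ_apply']
    exact contDiff_fst.contDiffOn.mul (smooth_dR ih).1

lemma periodic_iter {f : ℝ → ℝ → ℝ} (hper : ∀ ρ θ : ℝ, f ρ (θ + 2 * π) = f ρ θ) (m : ℕ) :
    ∀ ρ θ : ℝ, dT^[m] f ρ (θ + 2 * π) = dT^[m] f ρ θ := by
  induction m with
  | zero => exact hper
  | succ m ih =>
    intro ρ θ
    simp only [Function.iterate_succ_apply']
    simp only [dT] at ih ⊢
    rw [← deriv_comp_add_const]
    congr 1
    exact funext fun s => ih ρ s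

/-- Fourier coefficients. -/
noncomputable def cf (h : ℝ → ℝ) (k : ℤ) : ℂ :=
  ((2 * π)⁻¹ : ℝ) • ∫ θ in (0:ℝ)..(2 * π), Complex.exp (-(k * Complex.I * θ)) * (h θ : ℂ)

lemma norm_cexp (k : ℤ) (θ : ℝ) : ‖Complex.exp (k * Complex.I * θ)‖ = 1 := by
  rw [show (k * Complex.I * θ : ℂ) = ((k * θ : ℝ) : ℂ) * Complex.I by push_cast; ring]
  exact Complex.norm_exp_ofReal_mul_I _

lemma norm_cexp_neg (k : ℤ) (θ : ℝ) : ‖Complex.exp (-(k * Complex.I * θ))‖ = 1 := by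
  rw [Complex.exp_neg, norm_inv, norm_cexp, inv_one]

lemma cexp_deriv (c : ℂ) (θ : ℝ) :
    HasDerivAt (fun x : ℝ => Complex.exp (c * x)) (c * Complex.exp (c * θ)) θ := by
  have h1 : HasDerivAt (fun x : ℝ => c * (x : ℂ)) c θ := by
    simpa using (Complex.ofRealCLM.hasDerivAt (x := θ)).const_mul c
  refine h1.cexp.congr_deriv (mul_comm _ _)

lemma cf_bound {h : ℝ → ℝ} {M : ℝ} (hM : ∀ θ, |h θ| ≤ M) (k : ℤ) : ‖cf h k‖ ≤ M := by
  have hp : (0:ℝ) < 2 * π := by positivity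
  rw [cf, norm_smul, Real.norm_of_nonneg (by positivity)]
  have := intervalIntegral.norm_integral_le_of_norm_le_const (a := 0) (b := 2 * π)
    (f := fun θ : ℝ => Complex.exp (-(k * Complex.I * θ)) * (h θ : ℂ)) (C := M) (fun θ _ => by
      rw [norm_mul, norm_cexp_neg, one_mul, Complex.norm_real]; exact hM θ)
  rw [sub_zero, abs_of_pos hp] at this
  calc _ ≤ (2 * π)⁻¹ * (M * (2 * π)) := by gcongr
    _ = M := by field_simp

lemma cf_parts {h h' : ℝ → ℝ} (hd : ∀ θ, HasDerivAt h (h' θ) θ) (hc : Continuous h')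
    (hper : h (2 * π) = h 0) (k : ℤ) : cf h' k = (Complex.I * k) * cf h k := by
  have hcont : Continuous h := continuous_iff_continuousAt.2 fun θ => (hd θ).continuousAt
  have e1 : ∀ x : ℝ, HasDerivAt (fun x : ℝ => Complex.exp (-(k * Complex.I * x)))
      (-(k * Complex.I) * Complex.exp (-(k * Complex.I * x))) x := by
    intro x
    have := cexp_deriv (-(k * Complex.I)) x
    simpa only [neg_mul] using this
  have e2 : ∀ x : ℝ, HasDerivAt (fun x : ℝ => (h x : ℂ)) (h' x : ℂ) x := fun x => (hd x).ofReal_comp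
  have := intervalIntegral.integral_mul_deriv_eq_deriv_mul (a := 0) (b := 2 * π)
    (fun x _ => e1 x) (fun x _ => e2 x)
    (by apply Continuous.intervalIntegrable; fun_prop)
    (by apply Continuous.intervalIntegrable; fun_prop)
  rw [cf, cf, this]
  have hone : Complex.exp (-(k * Complex.I * ((2 * π : ℝ) : ℂ))) = 1 := by
    rw [Complex.exp_neg, show (k * Complex.I * ((2 * π : ℝ) : ℂ)) = k * (2 * π * Complex.I) by
      push_cast; ring, Complex.exp_int_mul_two_pi_mul_I, inv_one]
  rw [hone, hper]
  simp only [Complex.ofReal_zero, mul_zero, neg_zero, Complex.exp_zero, sub_self, zero_sub, mul_assoc,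
    intervalIntegral.integral_const_mul, neg_mul, intervalIntegral.integral_neg, neg_neg,
    Complex.real_smul]
  ring

lemma cf_deriv {u u' : ℝ → ℝ → ℝ}
    (hu : ContinuousOn (fun p : ℝ × ℝ => u p.1 p.2) {p : ℝ × ℝ | 0 < p.1 ∧ p.1 ≤ 1})
    (hu' : ContinuousOn (fun p : ℝ × ℝ => u' p.1 p.2) {p : ℝ × ℝ | 0 < p.1 ∧ p.1 ≤ 1})
    (hd : ∀ ρ ∈ Ioc (0:ℝ) 1, ∀ θ, HasDerivWithinAt (fun x => u x θ) (u' ρ θ) (Ioc 0 1) ρ)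
    (k : ℤ) : ∀ ρ ∈ Ioc (0:ℝ) 1,
      HasDerivWithinAt (fun x => cf (u x) k) (cf (u' ρ) k) (Ioc 0 1) ρ := by
  intro ρ hρ
  have hp : (0:ℝ) < 2 * π := by positivity
  have hmin : ∀ x : ℝ, 0 < x → min x 1 ∈ Ioc (0:ℝ) 1 := fun x hx =>
    ⟨lt_min hx one_pos, min_le_right _ _⟩
  have sl : ∀ x ∈ Ioc (0:ℝ) 1, Continuous (u x) := fun x hx =>
    hu.comp_continuous (f := fun θ => (x, θ)) (by fun_prop) (fun _ => hx)
  have sl' : ∀ x ∈ Ioc (0:ℝ) 1, Continuous (u' x) := fun x hx =>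
    hu'.comp_continuous (f := fun θ => (x, θ)) (by fun_prop) (fun _ => hx)
  obtain ⟨B, hB⟩ := ((isCompact_Icc (a := ρ/2) (b := (1:ℝ))).prod
    (isCompact_Icc (a := (0:ℝ)) (b := 2 * π))).exists_bound_of_continuousOn
    (hu'.mono (fun p hp => ⟨by have := hp.1.1; have := hρ.1; linarith, hp.1.2⟩))
  set F : ℝ → ℝ → ℂ := fun x θ => Complex.exp (-(k * Complex.I * θ)) *
    ((u (min x 1) θ + (x - min x 1) • u' 1 θ : ℝ) : ℂ) with hF
  set F' : ℝ → ℝ → ℂ := fun x θ => Complex.exp (-(k * Complex.I * θ)) * (u' (min x 1) θ : ℂ) with hF'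
  have hFc : ∀ x, 0 < x → Continuous (F x) := by
    intro x hx
    have := sl _ (hmin x hx)
    have := sl' 1 ⟨one_pos, le_rfl⟩
    simp only [hF]
    fun_prop
  have hFc' : ∀ x, 0 < x → Continuous (F' x) := by
    intro x hx
    have := sl' _ (hmin x hx)
    simp only [hF']
    fun_prop
  have main := intervalIntegral.hasDerivAt_integral_of_dominated_loc_of_deriv_le (μ := volume)
    (a := 0) (b := 2 * π) (F := F) (F' := F') (x₀ := ρ) (s := Ioi (ρ/2)) (bound := fun _ => B)
    (Ioi_mem_nhds (by linarith [hρ.1]))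
    (by
      filter_upwards [Ioi_mem_nhds hρ.1] with x hx
      exact (hFc x hx).aestronglyMeasurable)
    ((hFc ρ hρ.1).intervalIntegrable _ _)
    (hFc' ρ hρ.1).aestronglyMeasurable
    (ae_of_all _ fun θ hθ x hx => by
      rw [uIoc_of_le hp.le] at hθ
      simp only [hF']
      rw [norm_mul, norm_cexp_neg, one_mul, Complex.norm_real]
      have hx : ρ / 2 < x := hx
      exact hB (min x 1, θ) ⟨⟨le_min hx.le (by linarith [hρ.2, hρ.1]), min_le_right _ _⟩, hθ.1.le, hθ.2⟩)
    (by simp)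
    (ae_of_all _ fun θ hθ x hx => by
      have hx : ρ / 2 < x := hx
      have hx0 : 0 < x := by linarith [hρ.1]
      have := ext_hasDeriv (u := fun x => u x θ) (u' := fun x => u' x θ) (fun ρ hρ => hd ρ hρ θ) hx0
      exact (this.ofReal_comp).const_mul _)
  have m2 := (main.2.const_smul ((2 * π)⁻¹ : ℝ)).hasDerivWithinAt (s := Ioc 0 1)
  have eF : ∀ x ∈ Ioc (0:ℝ) 1, cf (u x) k = ((2 * π)⁻¹ : ℝ) • ∫ θ in (0:ℝ)..(2 * π), F x θ := by
    intro x hx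
    simp only [cf, hF, min_eq_left hx.2, sub_self, zero_smul, add_zero]
  refine (m2.congr eF (eF ρ hρ)).congr_deriv ?_
  simp only [cf, hF', min_eq_left hρ.2]

lemma cf_hasSum {h : ℝ → ℝ} (hc : Continuous h) (hper : ∀ θ, h (θ + 2 * π) = h θ)
    (hs : Summable (cf h)) (θ : ℝ) :
    HasSum (fun k : ℤ => cf h k * Complex.exp (k * Complex.I * θ)) (h θ : ℂ) := by
  have hp : (0:ℝ) < 2 * π := by positivity
  have : Fact ((0:ℝ) < 2 * π) := ⟨hp⟩
  have hP : Function.Periodic (fun θ => (h θ : ℂ)) (2 * π) := fun θ => by simp [hper]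
  let H : C(AddCircle (2 * π), ℂ) := ⟨hP.lift, by
    apply continuous_coinduced_dom.mpr
    exact Complex.continuous_ofReal.comp hc⟩
  have hH : ∀ x : ℝ, H (x : AddCircle (2 * π)) = (h x : ℂ) := fun x => hP.lift_coe x
  have e : ∀ (k : ℤ) (x : ℝ), fourier k (x : AddCircle (2 * π)) = Complex.exp (k * Complex.I * x) := by
    intro k x
    rw [fourier_coe_apply]
    congr 1
    have : (π : ℂ) ≠ 0 := by exact_mod_cast Real.pi_ne_zero
    push_cast
    field_simp
  have hcf : ∀ k, fourierCoeff H k = cf h k := by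
    intro k
    rw [fourierCoeff_eq_intervalIntegral _ _ 0, cf, zero_add, one_div]
    congr 1
    apply intervalIntegral.integral_congr
    intro x _
    simp only [e, hH, smul_eq_mul]
    push_cast
    ring_nf
  have := has_pointwise_sum_fourier_series_of_summable (f := H)
    (by rw [show fourierCoeff (H : AddCircle (2 * π) → ℂ) = cf h from funext hcf]; exact hs)
    (θ : AddCircle (2 * π))
  rw [hH] at this
  simpa only [hcf, e, smul_eq_mul] using this

/-- Summability of the standard weights. -/
lemma weights : Summable (fun k : ℤ => ((1 + |(k:ℝ)|) ^ 2)⁻¹) := by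
  have h1 : Summable (fun k : ℤ => ((|(k:ℝ)|) ^ 2)⁻¹) := by
    have := (Real.summable_one_div_int_pow (p := 2)).2 (by norm_num)
    simpa using this
  have h2 : Summable (fun k : ℤ => (if k = 0 then (1:ℝ) else 0) + ((|(k:ℝ)|) ^ 2)⁻¹) :=
    (summable_of_ne_finset_zero (s := {0}) (fun k hk => by simp at hk; simp [hk])).add h1
  refine Summable.of_nonneg_of_le (fun k => by positivity) (fun k => ?_) h2
  by_cases hk : k = 0
  · subst hk; simp
  · have : 0 < |(k:ℝ)| := by positivity
    simp only [hk, if_false, zero_add]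
    gcongr
    linarith

/-- Fourier coefficients of a smooth bounded `f`. -/
lemma rapid_of_smooth {f : ℝ → ℝ → ℝ} {q : ℝ}
    (hf : ContDiffOn ℝ (⊤ : ℕ∞) (fun p : ℝ × ℝ => f p.1 p.2) {p : ℝ × ℝ | 0 < p.1 ∧ p.1 ≤ 1})
    (hper : ∀ ρ θ : ℝ, f ρ (θ + 2 * π) = f ρ θ)
    (hbound : ∀ k₁ k₂ : ℕ, ∃ C : ℝ, ∀ ρ θ : ℝ, 0 < ρ → ρ ≤ 1 →
      |pdRhoW^[k₁] (dT^[k₂] f) ρ θ| ≤ C * ρ ^ q) :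
    ∃ c : ℤ → ℕ → ℝ → ℂ, Rapid q c ∧ (∀ k ρ, c k 0 ρ = cf (f ρ) k) := by
  let c : ℤ → ℕ → ℕ → ℝ → ℂ := fun k j m ρ => cf (pdRhoW^[j] (dT^[m] f) ρ) k
  have hder : ∀ k j m, ∀ ρ ∈ Ioc (0:ℝ) 1,
      HasDerivWithinAt (c k j m) (ρ⁻¹ • c k (j+1) m ρ) (Ioc 0 1) ρ := by
    intro k j m ρ hρ
    have hs := smooth_iter hf j m
    have hd := smooth_dR hs
    refine (cf_deriv hs.continuousOn hd.1.continuousOn hd.2 k ρ hρ).congr_deriv ?_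
    have h0 : (ρ:ℂ) ≠ 0 := by exact_mod_cast hρ.1.ne'
    simp only [c, Function.iterate_succ_apply', cf, pdRhoW]
    rw [smul_comm]
    congr 1
    rw [← intervalIntegral.integral_smul]
    congr 1
    funext θ
    rw [Complex.real_smul]
    push_cast
    field_simp
  have hstep : ∀ k j m, ∀ ρ ∈ Ioc (0:ℝ) 1, c k j (m+1) ρ = (Complex.I * k) * c k j m ρ := by
    intro k j m
    induction j with
    | zero =>
      intro ρ hρ
      have hs := smooth_iter hf 0 m
      have hs1 := smooth_iter hf 0 (m+1)
      have hd := (smooth_dT hs).2 ρ hρ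
      simp only [c, Function.iterate_zero, id, Function.iterate_succ_apply'] at hs1 hd ⊢
      refine cf_parts hd ?_ ?_ k
      · exact hs1.continuousOn.comp_continuous (f := fun θ => (ρ, θ)) (by fun_prop) (fun _ => hρ)
      · have := periodic_iter hper m ρ 0
        rwa [zero_add] at this
    | succ j ih =>
      intro ρ hρ
      have h1 := hder k j (m+1) ρ hρ
      have h2 := ((hder k j m ρ hρ).const_mul (Complex.I * k)).congr ih (ih ρ hρ)
      have := (uniqueDiffOn_Ioc (0:ℝ) 1 ρ hρ).eq_deriv _ h1 h2
      rw [mul_smul_comm] at this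
      exact smul_right_injective ℂ (inv_ne_zero hρ.1.ne') this
  have hpow : ∀ k j m, ∀ ρ ∈ Ioc (0:ℝ) 1, c k j m ρ = (Complex.I * k) ^ m * c k j 0 ρ := by
    intro k j m ρ hρ
    induction m with
    | zero => simp
    | succ m ih => rw [hstep k j m ρ hρ, ih]; ring
  refine ⟨fun k j => c k j 0, ⟨fun k j => hder k j 0, fun j m => ?_⟩, fun _ _ => rfl⟩
  obtain ⟨A, hA⟩ := hbound j 0
  obtain ⟨B, hB⟩ := hbound j m
  refine ⟨2 ^ m * (A + B), fun k ρ hρ => ?_⟩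
  have h1 : ‖c k j 0 ρ‖ ≤ A * ρ ^ q := cf_bound (fun θ => hA ρ θ hρ.1 hρ.2) k
  have h2 : ‖c k j m ρ‖ ≤ B * ρ ^ q := cf_bound (fun θ => hB ρ θ hρ.1 hρ.2) k
  rw [hpow k j m ρ hρ, norm_mul, norm_pow, norm_mul, Complex.norm_I, one_mul, Complex.norm_intCast] at h2
  have hk := abs_nonneg (k:ℝ)
  have h3 : (1 + |(k:ℝ)|) ^ m ≤ 2 ^ m * (1 + |(k:ℝ)| ^ m) := by
    rcases le_total |(k:ℝ)| 1 with h | h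
    · calc (1 + |(k:ℝ)|) ^ m ≤ 2 ^ m := by gcongr; linarith
        _ ≤ 2 ^ m * (1 + |(k:ℝ)| ^ m) := le_mul_of_one_le_right (by positivity) (by
          have := pow_nonneg hk m; linarith)
    · calc (1 + |(k:ℝ)|) ^ m ≤ (2 * |(k:ℝ)|) ^ m := by gcongr; linarith
        _ = 2 ^ m * |(k:ℝ)| ^ m := mul_pow _ _ _
        _ ≤ _ := by gcongr; linarith
  calc (1 + |(k:ℝ)|) ^ m * ‖c k j 0 ρ‖ ≤ 2 ^ m * (1 + |(k:ℝ)| ^ m) * ‖c k j 0 ρ‖ := by gcongr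
    _ = 2 ^ m * (‖c k j 0 ρ‖ + |(k:ℝ)| ^ m * ‖c k j 0 ρ‖) := by ring
    _ ≤ 2 ^ m * (A * ρ ^ q + B * ρ ^ q) := by
      exact mul_le_mul_of_nonneg_left (add_le_add h1 h2) (by positivity)
    _ = _ := by ring

/-- Terms of the Fourier series of `(ρ∂_ρ)^j ∂_θ^m w`. -/
noncomputable def fterm (w : ℤ → ℕ → ℝ → ℂ) (j m : ℕ) (ρ θ : ℝ) (k : ℤ) : ℂ :=
  w k j ρ * ((Complex.I * k) ^ m * Complex.exp (k * Complex.I * θ))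

lemma fterm_bd {r : ℝ} {w : ℤ → ℕ → ℝ → ℂ} (hw : Rapid r w) (j m : ℕ) :
    ∃ A : ℝ, 0 ≤ A ∧ ∀ k : ℤ, ∀ ρ ∈ Ioc (0:ℝ) 1, ∀ θ,
      ‖fterm w j m ρ θ k‖ ≤ A * ρ ^ r * ((1 + |(k:ℝ)|) ^ 2)⁻¹ := by
  obtain ⟨A, hA⟩ := hw.bd j (m+2)
  refine ⟨A, ?_, fun k ρ hρ θ => ?_⟩
  · have := hA 0 1 ⟨one_pos, le_rfl⟩
    rw [Real.one_rpow, mul_one] at this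
    exact le_trans (by positivity) this
  · have hk := abs_nonneg (k:ℝ)
    rw [fterm, norm_mul, norm_mul, norm_cexp, mul_one, norm_pow, norm_mul, Complex.norm_I, one_mul,
      Complex.norm_intCast, ← div_eq_mul_inv, le_div_iff₀ (by positivity)]
    refine le_trans ?_ (hA k ρ hρ)
    rw [pow_add]
    calc ‖w k j ρ‖ * |(k:ℝ)| ^ m * (1 + |(k:ℝ)|) ^ 2
        ≤ ‖w k j ρ‖ * (1 + |(k:ℝ)|) ^ m * (1 + |(k:ℝ)|) ^ 2 := by gcongr; linarith
      _ = _ := by ring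

lemma fterm_summable {r : ℝ} {w : ℤ → ℕ → ℝ → ℂ} (hw : Rapid r w) (j m : ℕ)
    {ρ : ℝ} (hρ : ρ ∈ Ioc (0:ℝ) 1) (θ : ℝ) : Summable (fterm w j m ρ θ) := by
  obtain ⟨A, -, hA⟩ := fterm_bd hw j m
  exact Summable.of_norm_bounded (weights.mul_left (A * ρ ^ r)) (fun k => hA k ρ hρ θ)

/-- The sum of the Fourier series. -/
noncomputable def WW (w : ℤ → ℕ → ℝ → ℂ) (j m : ℕ) (ρ θ : ℝ) : ℝ := (∑' k, fterm w j m ρ θ k).re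

lemma re_hasDerivAt {u : ℝ → ℂ} {u' : ℂ} {x : ℝ} (h : HasDerivAt u u' x) :
    HasDerivAt (fun x => (u x).re) u'.re x :=
  (Complex.reCLM.hasFDerivAt (x := u x)).comp_hasDerivAt x h

lemma WW_fam {r : ℝ} (hr : 0 < r) {w : ℤ → ℕ → ℝ → ℂ} (hw : Rapid r w) : Fam (WW w) := by
  have hle : ∀ ρ ∈ Ioc (0:ℝ) 1, ρ ^ r ≤ 1 := fun ρ hρ => Real.rpow_le_one hρ.1.le hρ.2 hr.le
  refine ⟨fun j m => ?_, fun j m ρ hρ θ => ?_, fun j m ρ hρ θ => ?_⟩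
  · obtain ⟨A, hA0, hA⟩ := fterm_bd hw j m
    refine Complex.continuous_re.comp_continuousOn ?_
    refine continuousOn_tsum (u := fun k : ℤ => A * ((1 + |(k:ℝ)|) ^ 2)⁻¹) ?_ (weights.mul_left A) ?_
    · intro k
      refine ContinuousOn.mul ?_ (Continuous.continuousOn (by fun_prop))
      have : ContinuousOn (w k j) (Ioc 0 1) := fun ρ hρ => (hw.der k j ρ hρ).continuousWithinAt
      exact this.comp continuous_fst.continuousOn (fun p hp => hp)
    · intro k p hp
      refine (hA k p.1 hp p.2).trans ?_
      have := hle p.1 hp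
      gcongr
      exact mul_le_of_le_one_right hA0 this
  · obtain ⟨A, hA0, hA⟩ := fterm_bd hw (j+1) m
    have hρ0 : 0 < ρ := hρ.1
    have hd : ∀ k : ℤ, ∀ x ∈ Ioc (0:ℝ) 1, HasDerivWithinAt (fun x => fterm w j m x θ k)
        (x⁻¹ • fterm w (j+1) m x θ k) (Ioc 0 1) x := by
      intro k x hx
      have := (hw.der k j x hx).mul_const ((Complex.I * k) ^ m * Complex.exp (k * Complex.I * θ))
      rw [smul_mul_assoc] at this
      exact this
    have main := hasDerivAt_tsum_of_isPreconnected (u := fun k : ℤ => (ρ/2)⁻¹ * (A * ((1 + |(k:ℝ)|) ^ 2)⁻¹))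
      (t := Ioi (ρ/2)) (y₀ := ρ) (y := ρ)
      (g := fun k x => fterm w j m (min x 1) θ k + (x - min x 1) • ((1:ℝ)⁻¹ • fterm w (j+1) m 1 θ k))
      (g' := fun k x => (min x 1)⁻¹ • fterm w (j+1) m (min x 1) θ k)
      ((weights.mul_left A).mul_left _) isOpen_Ioi isPreconnected_Ioi
      (fun k x hx => by
        have hx : ρ / 2 < x := hx
        exact ext_hasDeriv (hd k) (by linarith))
      (fun k x hx => by
        have hx : ρ / 2 < x := hx
        have h1 : ρ / 2 ≤ min x 1 := le_min hx.le (by linarith [hρ.2])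
        have h2 : min x 1 ∈ Ioc (0:ℝ) 1 := ⟨by linarith, min_le_right _ _⟩
        have h3 := h2.1
        rw [norm_smul, Real.norm_of_nonneg (inv_nonneg.2 h2.1.le)]
        gcongr
        refine (hA k _ h2 θ).trans ?_
        have := hle _ h2
        gcongr
        exact mul_le_of_le_one_right hA0 this)
      (by show ρ / 2 < ρ; linarith)
      (by
        simp only [min_eq_left hρ.2, sub_self, zero_smul, add_zero]
        exact fterm_summable hw j m hρ θ)
      (by show ρ / 2 < ρ; linarith)
    have m2 := (re_hasDerivAt main).hasDerivWithinAt (s := Ioc 0 1)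
    have e : ∀ x ∈ Ioc (0:ℝ) 1, WW w j m x θ = (∑' k, (fterm w j m (min x 1) θ k +
        (x - min x 1) • ((1:ℝ)⁻¹ • fterm w (j+1) m 1 θ k))).re := by
      intro x hx
      simp only [min_eq_left hx.2, sub_self, zero_smul, add_zero, WW]
    refine (m2.congr e (e ρ hρ)).congr_deriv ?_
    simp only [min_eq_left hρ.2, WW]
    rw [(fterm_summable hw (j+1) m hρ θ).tsum_const_smul, Complex.real_smul, Complex.re_ofReal_mul]
  · obtain ⟨A, hA0, hA⟩ := fterm_bd hw j (m+1)
    have main := hasDerivAt_tsum (u := fun k : ℤ => A * ρ ^ r * ((1 + |(k:ℝ)|) ^ 2)⁻¹) (y₀ := θ)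
      (g := fun k x => fterm w j m ρ x k) (g' := fun k x => fterm w j (m+1) ρ x k)
      (weights.mul_left _)
      (fun k x => by
        have := ((cexp_deriv (k * Complex.I) x).const_mul ((Complex.I * k) ^ m)).const_mul (w k j ρ)
        refine this.congr_deriv ?_
        rw [fterm]
        ring)
      (fun k x => hA k ρ hρ x) (fterm_summable hw j m hρ θ) θ
    exact re_hasDerivAt main

lemma WW_bd {r : ℝ} {w : ℤ → ℕ → ℝ → ℂ} (hw : Rapid r w) (j m : ℕ) :
    ∃ C : ℝ, ∀ ρ ∈ Ioc (0:ℝ) 1, ∀ θ, |WW w j m ρ θ| ≤ C * ρ ^ r := by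
  obtain ⟨A, hA0, hA⟩ := fterm_bd hw j m
  refine ⟨A * ∑' k : ℤ, ((1 + |(k:ℝ)|) ^ 2)⁻¹, fun ρ hρ θ => ?_⟩
  refine (Complex.abs_re_le_norm _).trans ?_
  refine (tsum_of_norm_bounded (weights.hasSum.mul_left (A * ρ ^ r)) (fun k => hA k ρ hρ θ)).trans
    (le_of_eq (by ring))

lemma exists_gap (r α : ℝ) (hr : 0 < r) (hα : 0 < α) (hne : ∀ k : ℕ, r ≠ α * k) :
    ∃ δ, 0 < δ ∧ ∀ k : ℤ, δ ≤ |r - α * abs (k:ℝ)| ∧ δ ≤ |r - -(α * abs (k:ℝ))| := by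
  obtain ⟨N, hN⟩ := exists_nat_gt ((r + 1) / α)
  rw [div_lt_iff₀ hα] at hN
  have hfin : ∀ n : ℕ, ∃ δ, 0 < δ ∧ ∀ k : ℕ, k < n → δ ≤ |r - α * k| := by
    intro n
    induction n with
    | zero => exact ⟨1, one_pos, fun k hk => absurd hk (Nat.not_lt_zero k)⟩
    | succ n ih =>
      obtain ⟨δ, h0, h⟩ := ih
      refine ⟨min δ |r - α * n|, lt_min h0 (abs_pos.2 (sub_ne_zero.2 (hne n))), fun k hk => ?_⟩
      rcases Nat.lt_succ_iff_lt_or_eq.1 hk with h1 | h1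
      · exact (min_le_left _ _).trans (h k h1)
      · subst h1; exact min_le_right _ _
  obtain ⟨δ, h0, h⟩ := hfin N
  refine ⟨min (min δ 1) r, lt_min (lt_min h0 one_pos) hr, fun k => ⟨?_, ?_⟩⟩
  · have hk : |(k:ℝ)| = (k.natAbs : ℝ) := by rw [Nat.cast_natAbs]; simp
    rw [hk]
    refine (min_le_left _ _).trans ?_
    rcases lt_or_ge k.natAbs N with h1 | h1
    · exact (min_le_left _ _).trans (h _ h1)
    · refine (min_le_right _ _).trans ?_
      have : (N:ℝ) ≤ k.natAbs := by exact_mod_cast h1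
      rw [abs_sub_comm]
      refine le_trans ?_ (le_abs_self _)
      nlinarith
  · refine (min_le_right _ _).trans (le_trans ?_ (le_abs_self _))
    have : 0 ≤ α * |(k:ℝ)| := by positivity
    linarith

lemma core (β r : ℝ) (hβ : -1 < β) (hr : 0 < r) (hne : ∀ k : ℕ, r ≠ (k : ℝ) / (β + 1))
    (f : ℝ → ℝ → ℝ)
    (hsmooth : ContDiffOn ℝ (⊤ : ℕ∞) (fun p : ℝ × ℝ => f p.1 p.2)
      {p : ℝ × ℝ | 0 < p.1 ∧ p.1 ≤ 1})
    (hper : ∀ ρ θ : ℝ, f ρ (θ + 2 * π) = f ρ θ)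
    (hbound : ∀ k₁ k₂ : ℕ, ∃ C : ℝ, ∀ ρ θ : ℝ, 0 < ρ → ρ ≤ 1 →
      |pdRhoW^[k₁] (dT^[k₂] f) ρ θ| ≤ C * ρ ^ (r - 2)) :
    ∃ w : ℝ → ℝ → ℝ, GoodSol β f w r := by
  have hb : 0 < β + 1 := by linarith
  set α : ℝ := (β + 1)⁻¹ with hα
  have hα0 : 0 < α := inv_pos.2 hb
  obtain ⟨δ, hδ, hgap⟩ := exists_gap r α hr hα0 (fun k => by
    have := hne k; rwa [div_eq_inv_mul] at this)
  obtain ⟨c, hc, hc0⟩ := rapid_of_smooth hsmooth hper hbound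
  obtain ⟨g, hg, hg0⟩ := hc.mulSq
  rw [sub_add_cancel] at hg
  have habs : ∀ k : ℤ, |α * abs (k:ℝ)| ≤ α * (1 + |(k:ℝ)|) := fun k => by
    rw [abs_of_nonneg (by positivity)]; gcongr; linarith
  obtain ⟨v, hv, hvs⟩ := hg.solve (fun k => -(α * |(k:ℝ)|)) α δ hδ
    (fun k => by rw [abs_neg]; exact habs k) (fun k => (hgap k).2)
  obtain ⟨w, hw, hws⟩ := hv.solve (fun k => α * |(k:ℝ)|) α δ hδ habs (fun k => (hgap k).1)
  have hF := WW_fam hr hw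
  refine ⟨WW w 0 0, ?_, ?_, ?_, ?_⟩
  · rw [contDiffOn_infty]
    exact fun n => hF.contDiffOn n 0 0
  · intro ρ θ
    have : fterm w 0 0 ρ (θ + 2 * π) = fterm w 0 0 ρ θ := by
      funext k
      rw [fterm, fterm]
      congr 2
      rw [show (k * Complex.I * ((θ + 2 * π : ℝ) : ℂ)) = k * Complex.I * θ + k * (2 * π * Complex.I) by
        push_cast; ring, Complex.exp_add, Complex.exp_int_mul_two_pi_mul_I, mul_one]
    rw [WW, WW, this]
  · intro ρ θ h0 h1
    have hρ : ρ ∈ Ioc (0:ℝ) 1 := ⟨h0, h1⟩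
    have hT : dT (dT (WW w 0 0)) ρ θ = WW w 0 2 ρ θ := hF.iter 0 2 ρ hρ θ
    have hR : ∀ x ∈ Ioc (0:ℝ) 1, ∀ θ, dR (WW w 0 0) x θ = x⁻¹ * WW w 1 0 x θ :=
      fun x hx θ => dR_eq hx (hF.dr 0 0 x hx θ)
    have hRR : dR (dR (WW w 0 0)) ρ θ =
        -(ρ ^ 2)⁻¹ * WW w 1 0 ρ θ + ρ⁻¹ * (ρ⁻¹ * WW w 2 0 ρ θ) := by
      rw [dR_congr (v := fun x θ => x⁻¹ * WW w 1 0 x θ) hR hρ]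
      exact dR_eq hρ (((hasDerivAt_inv h0.ne').hasDerivWithinAt).mul (hF.dr 1 0 ρ hρ θ))
    rw [coneLapW, hRR, hR ρ hρ, hT]
    have hsum : WW w 2 0 ρ θ + α ^ 2 * WW w 0 2 ρ θ = ρ ^ 2 * f ρ θ := by
      have hcs : Summable (cf (f ρ)) := by
        have := (fterm_summable hc 0 0 hρ 0)
        refine this.congr (fun k => ?_)
        simp [fterm, hc0]
      have hfc : Continuous (f ρ) :=
        hsmooth.continuousOn.comp_continuous (f := fun θ => (ρ, θ)) (by fun_prop) (fun _ => hρ)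
      have h3 := (cf_hasSum hfc (hper ρ) hcs θ).mul_left ((ρ ^ 2 : ℝ) : ℂ)
      have h4 := (fterm_summable hw 2 0 hρ θ).hasSum.add
        ((fterm_summable hw 0 2 hρ θ).hasSum.mul_left ((α ^ 2 : ℝ) : ℂ))
      have h5 : ∀ k : ℤ, fterm w 2 0 ρ θ k + ((α ^ 2 : ℝ) : ℂ) * fterm w 0 2 ρ θ k =
          ((ρ ^ 2 : ℝ) : ℂ) * (cf (f ρ) k * Complex.exp (k * Complex.I * θ)) := by
        intro k
        have hk : ((|(k:ℝ)| : ℝ) : ℂ) ^ 2 = (k:ℂ) ^ 2 := by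
          have := sq_abs (k:ℝ)
          exact_mod_cast this
        have e0 := hg0 k ρ
        rw [hc0, Complex.real_smul] at e0
        simp only [fterm]
        rw [hws k 1, hws k 0, hvs k 0, ← mul_assoc ((ρ ^ 2 : ℝ) : ℂ), ← e0]
        simp only [Complex.real_smul]
        push_cast
        rw [mul_pow Complex.I _ 2, Complex.I_sq, pow_zero]
        linear_combination ((α:ℂ) ^ 2 * w k 0 ρ * Complex.exp (k * Complex.I * θ)) * hk
      rw [funext h5] at h4
      have h6 := congrArg Complex.re (h4.unique h3)
      rw [Complex.add_re, Complex.re_ofReal_mul, Complex.re_ofReal_mul, Complex.ofReal_re] at h6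
      exact h6
    have hα2 : ((β + 1) ^ 2)⁻¹ = α ^ 2 := by rw [hα, inv_pow]
    rw [hα2]
    have : f ρ θ = (ρ ^ 2)⁻¹ * (WW w 2 0 ρ θ + α ^ 2 * WW w 0 2 ρ θ) := by
      rw [hsum]; field_simp
    rw [this]
    field_simp
    ring
  · intro k₁ k₂
    obtain ⟨C, hC⟩ := WW_bd hw k₁ k₂
    refine ⟨C, fun ρ θ h0 h1 => ?_⟩
    rw [hF.iter k₁ k₂ ρ ⟨h0, h1⟩ θ]
    exact hC ρ ⟨h0, h1⟩ θ

/-- for `f_o` smooth on `{0 < ρ ≤ 1}`, `2π`-periodic, with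
`|(ρ∂_ρ)^{k₁}∂_θ^{k₂} f_o| ≤ C(k₁,k₂) ρ^q`, the equation `△̃ w_o = f_o` has a solution
gaining two orders of decay in the non-resonant case `q ≠ k/(β+1) - 2`, and in the
resonant case, a solution gaining `q'` orders for each `q' < 2 + q`. -/
theorem stmt6 (β q : ℝ) (hβ : -1 < β) (hq : 0 ≤ q) (f : ℝ → ℝ → ℝ)
    (hsmooth : ContDiffOn ℝ (⊤ : ℕ∞) (fun p : ℝ × ℝ => f p.1 p.2)
      {p : ℝ × ℝ | 0 < p.1 ∧ p.1 ≤ 1})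
    (hper : ∀ ρ θ : ℝ, f ρ (θ + 2 * π) = f ρ θ)
    (hbound : ∀ k₁ k₂ : ℕ, ∃ C : ℝ, ∀ ρ θ : ℝ, 0 < ρ → ρ ≤ 1 →
      |pdRhoW^[k₁] (dT^[k₂] f) ρ θ| ≤ C * ρ ^ q) :
    ((∀ k : ℕ, q ≠ (k : ℝ) / (β + 1) - 2) → ∃ w : ℝ → ℝ → ℝ, GoodSol β f w (q + 2)) ∧
    (¬ (∀ k : ℕ, q ≠ (k : ℝ) / (β + 1) - 2) →
      ∀ q' : ℝ, q' < 2 + q → ∃ w : ℝ → ℝ → ℝ, GoodSol β f w q') := by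
  have hb : 0 < β + 1 := by linarith
  refine ⟨fun hne => ?_, fun _ q' hq' => ?_⟩
  · refine core β (q + 2) hβ (by linarith) (fun k hk => hne k (by linarith)) f hsmooth hper ?_
    simpa using hbound
  · -- choose a non-resonant exponent `r` with `max q' 1 ≤ r < q + 2`
    have hlt : max q' 1 < q + 2 := max_lt (by linarith) (by linarith)
    have hcount : (Set.range (fun k : ℕ => (k : ℝ) / (β + 1))).Countable := Set.countable_range _
    obtain ⟨r, hr, hrn⟩ : ∃ r ∈ Ioo (max q' 1) (q + 2),
        r ∉ Set.range (fun k : ℕ => (k : ℝ) / (β + 1)) := by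
      by_contra hcon
      push Not at hcon
      exact absurd (Cardinal.Real.Ioo_countable_iff.1 (hcount.mono hcon)) (not_le.2 hlt)
    have hr1 : 1 < r := (le_max_right _ _).trans_lt hr.1
    have hrq : q' < r := (le_max_left _ _).trans_lt hr.1
    obtain ⟨w, h1, h2, h3, h4⟩ := core β r hβ (by linarith) (fun k hk => hrn ⟨k, hk.symm⟩) f hsmooth
      hper (fun k₁ k₂ => by
        obtain ⟨C, hC⟩ := hbound k₁ k₂
        refine ⟨|C|, fun ρ θ h0 h1 => (hC ρ θ h0 h1).trans ?_⟩
        have := Real.rpow_le_rpow_of_exponent_ge h0 h1 (show r - 2 ≤ q by linarith [hr.2])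
        have h5 := Real.rpow_nonneg h0.le q
        exact mul_le_mul (le_abs_self C) this h5 (abs_nonneg C))
    refine ⟨w, h1, h2, h3, fun k₁ k₂ => ?_⟩
    obtain ⟨C, hC⟩ := h4 k₁ k₂
    refine ⟨|C|, fun ρ θ h0 h1 => (hC ρ θ h0 h1).trans ?_⟩
    have := Real.rpow_le_rpow_of_exponent_ge h0 h1 hrq.le
    have h5 := Real.rpow_nonneg h0.le r
    exact mul_le_mul (le_abs_self C) this h5 (abs_nonneg C)
end
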